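/- Main two-weight theorem: let Ω ⊂ ℝ^n be a bounded Boman domain with constant N ≥ 1 (with Whitney decomposition W(Ω)), 1 < p ≤ q < ∞, and (v, w) a pair of weights on Ω with w doubling in Ω with constant D and σ = v^{−1/(p−1)}. Suppose there exist constants C_w, δ_w > 0 such that for every Q ∈ W(Ω), w(E)/w(R) ≤ C_w (|E|/|R|)^{δ_w} for all Q*-dyadic cubes R ⊂ Q* and all measurable E ⊂ R, and that analogous constants C_σ, δ_σ > 0 exist for σ. Suppose further there exists K > 0 such that for every Q ∈ W(Ω), |R|^{−(1−1/n)p} w(R)^{p/q} σ(R)^{p−1} ≤ K for all Q*-dyadic cubes R ⊂ Q*. Then there is a constant C = C(n, p, q, N, D, K, C_w, C_σ, δ_w, δ_σ) > 0 such that for every u ∈ Lip_loc(Ω), (inf_{c∈ℝ} ∫_Ω |u(x) − c|^q w(x) dx)^{1/q} ≤ C (∫_Ω |∇u(x)|^p v(x) dx)^{1/p}. -/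

import Mathlib

open MeasureTheory ENNReal NNReal Set

noncomputable section

/-- Euclidean space `ℝ^n`. -/
abbrev Rn (n : ℕ) := EuclideanSpace ℝ (Fin n)

/-- The half-open cube `Q(x, r)` with midpoint `x` and side length `2r`. -/
def CubeC {n : ℕ} (x : Rn n) (r : ℝ) : Set (Rn n) :=
  {y | ∀ i, x i - r ≤ y i ∧ y i < x i + r}

/-- The weighted measure `w(E) = ∫_E w dx` of a set, as an extended nonnegative real. -/
def wMass {n : ℕ} (w : Rn n → ℝ) (E : Set (Rn n)) : ℝ≥0∞ :=
  ∫⁻ x in E, ENNReal.ofReal (w x)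

/-- The measure `w dx`. -/
def wMeasure {n : ℕ} (w : Rn n → ℝ) : Measure (Rn n) :=
  volume.withDensity fun x => ENNReal.ofReal (w x)

/-- The weighted average `u_{w;E} = w(E)⁻¹ ∫_E u w dx`. -/
def wAvg {n : ℕ} (w : Rn n → ℝ) (E : Set (Rn n)) (u : Rn n → ℝ) : ℝ :=
  ⨍ x in E, u x ∂(wMeasure w)

/-- A weight `w` is doubling in the open set `Ω` with constant `D`:
`w(Ω ∩ Q(x,2r)) ≤ D w(Ω ∩ Q(x,r))` for every cube `Q(x,r)` with midpoint `x ∈ Ω`. -/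
def DoublingIn {n : ℕ} (Ω : Set (Rn n)) (w : Rn n → ℝ) (D : ℝ) : Prop :=
  ∀ x ∈ Ω, ∀ r : ℝ, 0 < r →
    wMass w (Ω ∩ CubeC x (2 * r)) ≤ ENNReal.ofReal D * wMass w (Ω ∩ CubeC x r)

/-- The distance between two sets. -/
def setDist {n : ℕ} (A B : Set (Rn n)) : ℝ :=
  sInf {d : ℝ | ∃ x ∈ A, ∃ y ∈ B, d = dist x y}

/-- A Whitney decomposition of `Ω` with dimensional constant `Cdim`: a countable family of
pairwise disjoint half-open cubes covering `Ω`, such that the side length of each dilated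
cube `Q* = (9/8)Q` is comparable (with constant `Cdim`) to its distance from `∂Ω`, and the
dilated cubes have overlap bounded by `Cdim`. -/
structure WhitneyDecomp (n : ℕ) (Ω : Set (Rn n)) (Cdim : ℝ) where
  cubes : Set (Set (Rn n))
  countable : cubes.Countable
  center : Set (Rn n) → Rn n
  radius : Set (Rn n) → ℝ
  radius_pos : ∀ Q ∈ cubes, 0 < radius Q
  eq_cube : ∀ Q ∈ cubes, Q = CubeC (center Q) (radius Q)
  pairwise_disjoint : cubes.PairwiseDisjoint id
  union_eq : ⋃₀ cubes = Ω
  dist_lower : ∀ Q ∈ cubes,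
    9 / 4 * radius Q ≤ Cdim * setDist (CubeC (center Q) (9 / 8 * radius Q)) (frontier Ω)
  dist_upper : ∀ Q ∈ cubes,
    setDist (CubeC (center Q) (9 / 8 * radius Q)) (frontier Ω) ≤ Cdim * (9 / 4 * radius Q)
  overlap_finite : ∀ x : Rn n, {Q ∈ cubes | x ∈ CubeC (center Q) (9 / 8 * radius Q)}.Finite
  overlap_le : ∀ x : Rn n,
    (({Q ∈ cubes | x ∈ CubeC (center Q) (9 / 8 * radius Q)}).ncard : ℝ) ≤ Cdim

/-- The dilated Whitney cube `Q* = (9/8)Q`. -/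
def Qstar {n : ℕ} {Ω : Set (Rn n)} {Cdim : ℝ} (W : WhitneyDecomp n Ω Cdim)
    (Q : Set (Rn n)) : Set (Rn n) :=
  CubeC (W.center Q) (9 / 8 * W.radius Q)

/-- Two Whitney cubes `P, Q` are chained (with constant `c`) if there is a cube
`R ⊆ P* ∩ Q*` with `l(R) ≥ c · max{l(P*), l(Q*)}`. -/
def ChainLink {n : ℕ} {Ω : Set (Rn n)} {Cdim : ℝ} (W : WhitneyDecomp n Ω Cdim) (c : ℝ)
    (P Q : Set (Rn n)) : Prop :=
  ∃ (z : Rn n) (r : ℝ), 0 < r ∧ CubeC z r ⊆ Qstar W P ∩ Qstar W Q ∧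
    c * max (2 * (9 / 8 * W.radius P)) (2 * (9 / 8 * W.radius Q)) ≤ 2 * r

/-- `L` is a chain of Whitney cubes joining `P` to `Q`: a list of distinct Whitney cubes
starting at `P`, ending at `Q`, whose consecutive members are chained. -/
def IsChainFrom {n : ℕ} {Ω : Set (Rn n)} {Cdim : ℝ} (W : WhitneyDecomp n Ω Cdim) (c : ℝ)
    (P Q : Set (Rn n)) (L : List (Set (Rn n))) : Prop :=
  (∀ R ∈ L, R ∈ W.cubes) ∧ L.Nodup ∧ L.head? = some P ∧ L.getLast? = some Q ∧
    L.Chain' (ChainLink W c)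

/-- A Boman chain decomposition of `Ω` with constants `Cdim` (Whitney), `cdim` (chain link)
and `N` (Boman): a Whitney decomposition together with a chain decomposition with common
central cube such that the shadow of each `R` is contained in `NR`. -/
structure BomanDecomp (n : ℕ) (Ω : Set (Rn n)) (Cdim cdim N : ℝ)
    extends WhitneyDecomp n Ω Cdim where
  central : Set (Rn n)
  central_mem : central ∈ cubes
  chain : Set (Rn n) → List (Set (Rn n))
  chain_isChain : ∀ Q ∈ cubes, IsChainFrom toWhitneyDecomp cdim central Q (chain Q)
  shadow_subset : ∀ R ∈ cubes, ∀ Q ∈ cubes, R ∈ chain Q →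
    Q ⊆ CubeC (center R) (N * radius R)

/-- `IsDyadicSubC x r R` : `R` is a dyadic subcube of the cube `CubeC x r` (the cube itself
together with all cubes obtained from it by recursively bisecting each edge). -/
def IsDyadicSubC {n : ℕ} (x : Rn n) (r : ℝ) (R : Set (Rn n)) : Prop :=
  ∃ (k : ℕ) (m : Fin n → ℕ), (∀ i, m i < 2 ^ k) ∧
    R = {y : Rn n | ∀ i, x i - r + 2 * r * m i / 2 ^ k ≤ y i ∧
      y i < x i - r + 2 * r * m i / 2 ^ k + 2 * r / 2 ^ k}

/-- The truncated power integral `∫₀^m t^(s-1) dt = m^s / s`, valid for all `m ∈ [0, ∞]`. -/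
lemma lintegral_rpow_truncated {s : ℝ} (hs : 0 < s) (m : ℝ≥0∞) :
    ∫⁻ t in Ioi (0 : ℝ), (if ENNReal.ofReal t < m then ENNReal.ofReal (t ^ (s - 1)) else 0) =
      ENNReal.ofReal s⁻¹ * m ^ s := by
  have key : ∀ m : ℝ≥0, ∫⁻ t in Ioi (0 : ℝ),
      (if ENNReal.ofReal t < m then ENNReal.ofReal (t ^ (s - 1)) else 0) =
      ENNReal.ofReal s⁻¹ * (m : ℝ≥0∞) ^ s := by
    intro m
    have h1 : ∫⁻ t in Ioi (0 : ℝ),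
        (if ENNReal.ofReal t < m then ENNReal.ofReal (t ^ (s - 1)) else 0) =
        ∫⁻ t in Ioo (0 : ℝ) m, ENNReal.ofReal (t ^ (s - 1)) := by
      rw [← lintegral_indicator measurableSet_Ioi, ← lintegral_indicator measurableSet_Ioo]
      congr 1
      ext t
      by_cases ht : 0 < t
      · have : ENNReal.ofReal t < m ↔ t < m := by
          rw [← ENNReal.ofReal_coe_nnreal, ENNReal.ofReal_lt_ofReal_iff_of_nonneg ht.le]
        by_cases h : t < m <;> simp [indicator, ht, h, this]
      · simp [indicator, ht]
    rw [h1, setLIntegral_congr Ioo_ae_eq_Ioc]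
    have hintegrable : IntervalIntegrable (fun t : ℝ => t ^ (s - 1)) volume 0 m :=
      intervalIntegral.intervalIntegrable_rpow' (by linarith)
    rw [intervalIntegrable_iff_integrableOn_Ioc_of_le m.coe_nonneg] at hintegrable
    rw [← ofReal_integral_eq_lintegral_ofReal hintegrable,
      ← intervalIntegral.integral_of_le m.coe_nonneg,
      integral_rpow (Or.inl (by linarith))]
    · rw [sub_add_cancel, Real.zero_rpow hs.ne', sub_zero, ← ENNReal.ofReal_coe_nnreal,
        ENNReal.ofReal_rpow_of_nonneg m.coe_nonneg hs.le, ← ENNReal.ofReal_mul (by positivity)]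
      congr 1
      field_simp
    · filter_upwards [ae_restrict_mem measurableSet_Ioc] with t ht
      exact Real.rpow_nonneg ht.1.le _
  induction m with
  | coe m => exact key m
  | top =>
    rw [ENNReal.top_rpow_of_pos hs, ENNReal.mul_top (by simpa using hs)]
    refine ENNReal.eq_top_of_forall_nnreal_le fun r => ?_
    have hr := key ((s.toNNReal * r) ^ s⁻¹)
    have : ENNReal.ofReal s⁻¹ * (((s.toNNReal * r) ^ s⁻¹ : ℝ≥0) : ℝ≥0∞) ^ s = r := by
      rw [← ENNReal.coe_rpow_of_nonneg _ hs.le, ← NNReal.rpow_mul, inv_mul_cancel₀ hs.ne',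
        NNReal.rpow_one, ENNReal.ofReal, ← ENNReal.coe_mul, ← mul_assoc, Real.toNNReal_inv,
        inv_mul_cancel₀ (by simpa using hs), one_mul]
    rw [this] at hr
    rw [← hr]
    refine lintegral_mono fun t => ?_
    simp only [ENNReal.ofReal_lt_top, if_true]
    split_ifs <;> simp

/-- A family of sets is a Carleson family for `μ` if every finite subfamily contains a disjoint
subfamily carrying a fixed proportion of its total mass. -/
def IsCarlesonFamily {X ι : Type*} [MeasurableSpace X] (μ : Measure X) (B : ι → Set X)
    (A : ℝ≥0∞) : Prop :=
  ∀ s : Finset ι, ∃ t ⊆ s, (t : Set ι).PairwiseDisjoint B ∧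
    ∑ i ∈ s, μ (B i) ≤ A * ∑ i ∈ t, μ (B i)

section Carleson

variable {X ι : Type*} [MeasurableSpace X] {μ : Measure X} {B : ι → Set X} {A : ℝ≥0∞}

lemma IsCarlesonFamily.sum_le_of_lt_average (h : IsCarlesonFamily μ B A)
    (hB : ∀ i, MeasurableSet (B i)) (hfin : ∀ i, μ (B i) ≠ ∞) {g : X → ℝ≥0∞}
    (hg : Measurable g) (s : Finset ι) {r : ℝ≥0∞} (hr0 : r ≠ 0) (hr : r ≠ ∞)
    (hs : ∀ i ∈ s, r < (μ (B i))⁻¹ * ∫⁻ x in B i, g x ∂μ) :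
    ∑ i ∈ s, μ (B i) ≤ 2 * A * r⁻¹ * ∫⁻ x, (if r < 2 * g x then g x else 0) ∂μ := by
  obtain ⟨t, hts, hdisj, hsum⟩ := h s
  set G : X → ℝ≥0∞ := fun x => if r < 2 * g x then g x else 0 with hG
  have hGm : Measurable G :=
    Measurable.ite (measurableSet_lt measurable_const (hg.const_mul _)) hg measurable_const
  have hgG : ∀ x, g x ≤ G x + r / 2 := by
    intro x
    simp only [hG]
    split_ifs with hx
    · exact le_self_add
    · rw [zero_add, ENNReal.le_div_iff_mul_le (by simp) (by simp), mul_comm]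
      exact not_lt.mp hx
  have hone : ∀ i ∈ t, μ (B i) ≤ 2 * r⁻¹ * ∫⁻ x in B i, G x ∂μ := by
    intro i hi
    have h0 : μ (B i) ≠ 0 := by
      intro h0
      have := hs i (hts hi)
      rw [Measure.restrict_eq_zero.mpr h0] at this
      simp at this
    have h1 : r * μ (B i) ≤ ∫⁻ x in B i, g x ∂μ := by
      have := (hs i (hts hi)).le
      rwa [mul_comm, ← div_eq_mul_inv, ENNReal.le_div_iff_mul_le (Or.inl h0) (Or.inl (hfin i))]
        at this
    have h2 : ∫⁻ x in B i, g x ∂μ ≤ ∫⁻ x in B i, G x ∂μ + r / 2 * μ (B i) := by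
      calc ∫⁻ x in B i, g x ∂μ ≤ ∫⁻ x in B i, (G x + r / 2) ∂μ := lintegral_mono fun x => hgG x
        _ = _ := by rw [lintegral_add_left hGm]; simp
    have h3 : r / 2 * μ (B i) ≤ ∫⁻ x in B i, G x ∂μ := by
      have h4 := h1.trans h2
      have h5 : r * μ (B i) = r / 2 * μ (B i) + r / 2 * μ (B i) := by
        rw [← add_mul, ENNReal.add_halves]
      rw [h5] at h4
      exact (ENNReal.add_le_add_iff_right
        (ENNReal.mul_ne_top (ENNReal.div_ne_top hr (by simp)) (hfin i))).mp h4
    calc μ (B i) = 2 * r⁻¹ * (r / 2 * μ (B i)) := by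
          rw [div_eq_mul_inv, show 2 * r⁻¹ * (r * 2⁻¹ * μ (B i)) =
            (2 * 2⁻¹) * (r⁻¹ * r) * μ (B i) by ring,
            ENNReal.mul_inv_cancel (by simp) (by simp), ENNReal.inv_mul_cancel hr0 hr]
          simp
      _ ≤ _ := by gcongr
  calc ∑ i ∈ s, μ (B i) ≤ A * ∑ i ∈ t, μ (B i) := hsum
    _ ≤ A * ∑ i ∈ t, 2 * r⁻¹ * ∫⁻ x in B i, G x ∂μ := by
        gcongr with i hi
        exact hone i hi
    _ = A * (2 * r⁻¹ * ∫⁻ x in ⋃ i ∈ t, B i, G x ∂μ) := by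
        rw [← Finset.mul_sum, lintegral_biUnion_finset hdisj fun i _ => hB i]
    _ ≤ A * (2 * r⁻¹ * ∫⁻ x, G x ∂μ) := by
        gcongr
        exact Measure.restrict_le_self
    _ = _ := by ring

/-- The Carleson embedding theorem. -/
theorem IsCarlesonFamily.tsum_average_rpow_le [SFinite μ] (h : IsCarlesonFamily μ B A)
    (hB : ∀ i, MeasurableSet (B i)) (hfin : ∀ i, μ (B i) ≠ ∞) {g : X → ℝ≥0∞}
    (hg : Measurable g) {p : ℝ} (hp : 1 < p) :
    ∑' i, μ (B i) * ((μ (B i))⁻¹ * ∫⁻ x in B i, g x ∂μ) ^ p ≤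
      A * ENNReal.ofReal (2 ^ p * (p / (p - 1))) * ∫⁻ x, g x ^ p ∂μ := by
  classical
  have hp0 : 0 < p := by linarith
  have hp1 : 0 < p - 1 := by linarith
  rw [ENNReal.tsum_eq_iSup_sum]
  refine iSup_le fun s => ?_
  set m : ι → ℝ≥0∞ := fun i => (μ (B i))⁻¹ * ∫⁻ x in B i, g x ∂μ with hm
  have hpp : ENNReal.ofReal p * ENNReal.ofReal p⁻¹ = 1 := by
    rw [← ENNReal.ofReal_mul hp0.le, mul_inv_cancel₀ hp0.ne', ENNReal.ofReal_one]
  have hmeas : ∀ i, Measurable fun t : ℝ =>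
      (if ENNReal.ofReal t < m i then ENNReal.ofReal (t ^ (p - 1)) else 0) := fun i =>
    Measurable.ite (measurableSet_lt ENNReal.measurable_ofReal measurable_const)
      (ENNReal.measurable_ofReal.comp (measurable_id.pow_const _)) measurable_const
  have hlevel : ∀ t ∈ Ioi (0 : ℝ), ∑ i ∈ s, μ (B i) *
      (if ENNReal.ofReal t < m i then ENNReal.ofReal (t ^ (p - 1)) else 0) ≤
      2 * A * ∫⁻ x, g x *
        (if ENNReal.ofReal t < 2 * g x then ENNReal.ofReal (t ^ (p - 1 - 1)) else 0) ∂μ := by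
    intro t ht
    have ht : 0 < t := ht
    have h1 := h.sum_le_of_lt_average hB hfin hg (s.filter fun i => ENNReal.ofReal t < m i)
      (r := ENNReal.ofReal t) (by simpa using ht) (by simp)
      (fun i hi => (Finset.mem_filter.mp hi).2)
    calc ∑ i ∈ s, μ (B i) *
          (if ENNReal.ofReal t < m i then ENNReal.ofReal (t ^ (p - 1)) else 0)
        = ENNReal.ofReal (t ^ (p - 1)) *
            ∑ i ∈ s.filter fun i => ENNReal.ofReal t < m i, μ (B i) := by
          rw [Finset.mul_sum, Finset.sum_filter]
          refine Finset.sum_congr rfl fun i _ => ?_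
          split_ifs <;> simp [mul_comm]
      _ ≤ ENNReal.ofReal (t ^ (p - 1)) * (2 * A * (ENNReal.ofReal t)⁻¹ *
            ∫⁻ x, (if ENNReal.ofReal t < 2 * g x then g x else 0) ∂μ) := by gcongr
      _ = 2 * A * (ENNReal.ofReal (t ^ (p - 1 - 1)) *
            ∫⁻ x, (if ENNReal.ofReal t < 2 * g x then g x else 0) ∂μ) := by
          rw [Real.rpow_sub_one ht.ne' (p - 1), ENNReal.ofReal_div_of_pos ht, div_eq_mul_inv]
          ring
      _ = _ := by
          rw [← lintegral_const_mul _ (Measurable.ite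
            (measurableSet_lt measurable_const (hg.const_mul _)) hg measurable_const)]
          congr 2
          ext x
          split_ifs <;> simp [mul_comm]
  calc ∑ i ∈ s, μ (B i) * m i ^ p
      = ENNReal.ofReal p * ∫⁻ t in Ioi (0 : ℝ), ∑ i ∈ s, μ (B i) *
          (if ENNReal.ofReal t < m i then ENNReal.ofReal (t ^ (p - 1)) else 0) := by
        rw [lintegral_finsetSum _ fun i _ => (hmeas i).const_mul _, Finset.mul_sum]
        refine Finset.sum_congr rfl fun i _ => ?_
        rw [lintegral_const_mul _ (hmeas i), lintegral_rpow_truncated hp0,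
          show ENNReal.ofReal p * (μ (B i) * (ENNReal.ofReal p⁻¹ * m i ^ p)) =
            (ENNReal.ofReal p * ENNReal.ofReal p⁻¹) * (μ (B i) * m i ^ p) by ring, hpp, one_mul]
    _ ≤ ENNReal.ofReal p * ∫⁻ t in Ioi (0 : ℝ), 2 * A * ∫⁻ x, g x *
        (if ENNReal.ofReal t < 2 * g x then ENNReal.ofReal (t ^ (p - 1 - 1)) else 0) ∂μ := by
        exact mul_le_mul_right (setLIntegral_mono' measurableSet_Ioi hlevel) _
    _ = ENNReal.ofReal p * (2 * A * ∫⁻ x, g x * (ENNReal.ofReal (p - 1)⁻¹ *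
          (2 * g x) ^ (p - 1)) ∂μ) := by
        have hjoint : Measurable fun z : ℝ × X => g z.2 *
            (if ENNReal.ofReal z.1 < 2 * g z.2 then ENNReal.ofReal (z.1 ^ (p - 1 - 1)) else 0) := by
          refine (hg.comp measurable_snd).mul (Measurable.ite (measurableSet_lt
            (ENNReal.measurable_ofReal.comp measurable_fst)
            ((hg.comp measurable_snd).const_mul _)) ?_ measurable_const)
          exact ENNReal.measurable_ofReal.comp (measurable_fst.pow_const _)
        rw [lintegral_const_mul _ hjoint.lintegral_prod_right',
          lintegral_lintegral_swap hjoint.aemeasurable]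
        congr 3
        ext x
        dsimp only
        rw [lintegral_const_mul, lintegral_rpow_truncated hp1]
        exact Measurable.ite (measurableSet_lt ENNReal.measurable_ofReal measurable_const)
          (ENNReal.measurable_ofReal.comp (measurable_id.pow_const _)) measurable_const
    _ = A * ENNReal.ofReal (2 ^ p * (p / (p - 1))) * ∫⁻ x, g x ^ p ∂μ := by
        have : ∀ x, g x * (ENNReal.ofReal (p - 1)⁻¹ * (2 * g x) ^ (p - 1)) =
            ENNReal.ofReal (p - 1)⁻¹ * 2 ^ (p - 1) * g x ^ p := by
          intro x
          rw [ENNReal.mul_rpow_of_nonneg _ _ hp1.le]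
          have : g x ^ p = g x * g x ^ (p - 1) := by
            conv_lhs => rw [show p = 1 + (p - 1) by ring]
            rw [ENNReal.rpow_add_of_nonneg _ _ zero_le_one hp1.le, ENNReal.rpow_one]
          rw [this]
          ring
        simp_rw [this]
        rw [lintegral_const_mul _ (hg.pow_const _), ← mul_assoc, ← mul_assoc]
        congr 1
        rw [div_eq_mul_inv, ENNReal.ofReal_mul (by positivity), ENNReal.ofReal_mul hp0.le,
          ← ENNReal.ofReal_rpow_of_pos (by norm_num)]
        have : (2 : ℝ≥0∞) ^ p = 2 * 2 ^ (p - 1) := by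
          conv_lhs => rw [show p = 1 + (p - 1) by ring]
          rw [ENNReal.rpow_add_of_nonneg _ _ zero_le_one hp1.le, ENNReal.rpow_one]
        rw [show ENNReal.ofReal 2 = 2 by simp, this]
        ring

end Carleson

section Carleson

variable {X ι : Type*} [MeasurableSpace X] {μ : Measure X} {B : ι → Set X} {A : ℝ≥0∞}

lemma isCarlesonFamily_of_sparse {A' : ℝ≥0∞} {E : ι → Set X}
    (hE : ∀ i, MeasurableSet (E i)) (hEB : ∀ i, E i ⊆ B i)
    (hdisj : Pairwise fun i j => Disjoint (E i) (E j))
    (hmass : ∀ i, μ (B i) ≤ A * μ (E i))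
    (hcover : ∀ s : Finset ι, ∃ t ⊆ s, (t : Set ι).PairwiseDisjoint B ∧
      μ (⋃ i ∈ s, B i) ≤ A' * ∑ i ∈ t, μ (B i)) :
    IsCarlesonFamily μ B (A * A') := by
  intro s
  obtain ⟨t, hts, ht, hle⟩ := hcover s
  refine ⟨t, hts, ht, ?_⟩
  calc ∑ i ∈ s, μ (B i) ≤ ∑ i ∈ s, A * μ (E i) := Finset.sum_le_sum fun i _ => hmass i
    _ = A * μ (⋃ i ∈ s, E i) := by
        rw [← Finset.mul_sum, measure_biUnion_finset (fun i _ j _ hij => hdisj hij)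
          fun i _ => hE i]
    _ ≤ A * μ (⋃ i ∈ s, B i) := by
        gcongr with i _
        exact hEB i
    _ ≤ A * (A' * ∑ i ∈ t, μ (B i)) := by gcongr
    _ = _ := by ring

lemma IsCarlesonFamily.lintegral_sum_indicator_rpow_le [SFinite μ] (h : IsCarlesonFamily μ B A)
    (hB : ∀ i, MeasurableSet (B i)) (hfin : ∀ i, μ (B i) ≠ ∞) {q : ℝ} (hq : 1 < q)
    {a : ι → ℝ≥0∞} (ha : ∀ i, a i ≠ ∞) (s : Finset ι) :
    ∫⁻ x, (∑ i ∈ s, (B i).indicator (fun _ => a i) x) ^ q ∂μ ≤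
      (A * ENNReal.ofReal (2 ^ (q / (q - 1)) * q)) ^ (q - 1) * ∑ i ∈ s, a i ^ q * μ (B i) := by
  have hq0 : 0 < q := by linarith
  have hq1 : 0 < q - 1 := by linarith
  set F : X → ℝ≥0∞ := fun x => ∑ i ∈ s, (B i).indicator (fun _ => a i) x with hF
  have hFm : Measurable F :=
    Finset.measurable_fun_sum s fun i _ => measurable_const.indicator (hB i)
  have hsplit : ∀ x, F x ^ q = F x * F x ^ (q - 1) := by
    intro x
    conv_lhs => rw [show q = 1 + (q - 1) by ring]
    rw [ENNReal.rpow_add_of_nonneg _ _ zero_le_one hq1.le, ENNReal.rpow_one]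
  set I : ℝ≥0∞ := ∫⁻ x, F x ^ q ∂μ with hI
  have hItop : I ≠ ∞ := by
    have hle : ∀ x, F x ^ q ≤ (∑ i ∈ s, a i) ^ (q - 1) * F x := by
      intro x
      rw [hsplit, mul_comm]
      gcongr
      exact Finset.sum_le_sum fun i _ => indicator_le_self _ _ _
    refine ne_top_of_le_ne_top ?_ (lintegral_mono hle)
    rw [lintegral_const_mul _ hFm, lintegral_finsetSum _ fun i _ =>
      measurable_const.indicator (hB i)]
    refine ENNReal.mul_ne_top (ENNReal.rpow_ne_top_of_nonneg hq1.le ?_) ?_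
    · exact ENNReal.sum_ne_top.mpr fun i _ => ha i
    · refine ENNReal.sum_ne_top.mpr fun i _ => ?_
      rw [lintegral_indicator_const (hB i)]
      exact ENNReal.mul_ne_top (ha i) (hfin i)
  set q' : ℝ := q / (q - 1) with hq'
  have hconj : q.HolderConjugate q' := Real.HolderConjugate.conjExponent hq
  have hq'1 : 1 < q' := hconj.symm.lt
  have hq'q : q' / (q' - 1) = q := by
    rw [hq']
    field_simp
    ring
  set m : ι → ℝ≥0∞ := fun i => (μ (B i))⁻¹ * ∫⁻ x in B i, F x ^ (q - 1) ∂μ with hm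
  have hterm : ∀ i, a i * ∫⁻ x in B i, F x ^ (q - 1) ∂μ =
      (a i * μ (B i) ^ (1 / q)) * (μ (B i) ^ (1 / q') * m i) := by
    intro i
    have h1 : μ (B i) * m i = ∫⁻ x in B i, F x ^ (q - 1) ∂μ := by
      rcases eq_or_ne (μ (B i)) 0 with h0 | h0
      · rw [h0, Measure.restrict_eq_zero.mpr h0]
        simp
      · rw [hm, ← mul_assoc, ENNReal.mul_inv_cancel h0 (hfin i), one_mul]
    have h2 : μ (B i) ^ (1 / q) * μ (B i) ^ (1 / q') = μ (B i) := by
      rw [← ENNReal.rpow_add_of_nonneg _ _ (by positivity) (one_div_nonneg.mpr (by linarith)),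
        one_div, one_div, hconj.inv_add_inv_eq_one, ENNReal.rpow_one]
    rw [← h1]
    nth_rewrite 1 [← h2]
    ring
  have hIsum : I = ∑ i ∈ s, a i * ∫⁻ x in B i, F x ^ (q - 1) ∂μ := by
    have : ∀ x, F x ^ q = ∑ i ∈ s, a i * (B i).indicator (fun x => F x ^ (q - 1)) x := by
      intro x
      rw [hsplit, hF, Finset.sum_mul]
      refine Finset.sum_congr rfl fun i _ => ?_
      by_cases hx : x ∈ B i <;> simp [hx]
    rw [hI]
    simp_rw [this]
    rw [lintegral_finsetSum _ fun i _ => ((hFm.pow_const _).indicator (hB i)).const_mul _]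
    refine Finset.sum_congr rfl fun i _ => ?_
    rw [lintegral_const_mul _ ((hFm.pow_const _).indicator (hB i)), lintegral_indicator (hB i)]
  have hq'q1 : (q - 1) * q' = q := by
    rw [hq']
    field_simp
  have hemb : ∑ i ∈ s, μ (B i) * m i ^ q' ≤
      A * ENNReal.ofReal (2 ^ q' * q) * I := by
    have := (ENNReal.sum_le_tsum s).trans
      (h.tsum_average_rpow_le hB hfin (hFm.pow_const (q - 1)) hq'1)
    simp_rw [← ENNReal.rpow_mul, hq'q1, hq'q] at this
    exact this
  set S : ℝ≥0∞ := ∑ i ∈ s, a i ^ q * μ (B i) with hS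
  set c : ℝ≥0∞ := A * ENNReal.ofReal (2 ^ q' * q) with hc
  have hmain : I ≤ S ^ (1 / q) * (c * I) ^ (1 / q') := by
    calc I = ∑ i ∈ s, (a i * μ (B i) ^ (1 / q)) * (μ (B i) ^ (1 / q') * m i) := by
          rw [hIsum]
          exact Finset.sum_congr rfl fun i _ => hterm i
      _ ≤ (∑ i ∈ s, (a i * μ (B i) ^ (1 / q)) ^ q) ^ (1 / q) *
          (∑ i ∈ s, (μ (B i) ^ (1 / q') * m i) ^ q') ^ (1 / q') :=
          ENNReal.inner_le_Lp_mul_Lq s _ _ hconj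
      _ = S ^ (1 / q) * (∑ i ∈ s, μ (B i) * m i ^ q') ^ (1 / q') := by
          have hq'0 : 0 < q' := by linarith
          congr 2 <;> refine Finset.sum_congr rfl fun i _ => ?_
          · rw [ENNReal.mul_rpow_of_nonneg _ _ hq0.le, ← ENNReal.rpow_mul,
              one_div_mul_cancel hq0.ne', ENNReal.rpow_one]
          · rw [ENNReal.mul_rpow_of_nonneg _ _ hq'0.le, ← ENNReal.rpow_mul,
              one_div_mul_cancel hq'0.ne', ENNReal.rpow_one]
      _ ≤ _ := by gcongr
  rcases eq_or_ne I 0 with h0 | h0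
  · rw [h0]
    exact zero_le
  · have hpow : I * I ^ (q - 1) ≤ (c ^ (q - 1) * S) * I ^ (q - 1) := by
      have h1 : I * I ^ (q - 1) = I ^ q := by
        conv_rhs => rw [show q = 1 + (q - 1) by ring]
        rw [ENNReal.rpow_add_of_nonneg _ _ zero_le_one hq1.le, ENNReal.rpow_one]
      have h2 : (S ^ (1 / q) * (c * I) ^ (1 / q')) ^ q = (c ^ (q - 1) * S) * I ^ (q - 1) := by
        rw [ENNReal.mul_rpow_of_nonneg _ _ hq0.le, ← ENNReal.rpow_mul, ← ENNReal.rpow_mul,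
          one_div_mul_cancel hq0.ne', ENNReal.rpow_one,
          show 1 / q' * q = q - 1 by rw [hq']; field_simp,
          ENNReal.mul_rpow_of_nonneg _ _ hq1.le]
        ring
      rw [h1, ← h2]
      exact ENNReal.rpow_le_rpow hmain hq0.le
    refine (ENNReal.mul_le_mul_iff_left ?_ ?_).mp hpow
    · exact (ENNReal.rpow_pos (pos_iff_ne_zero.mpr h0) hItop).ne'
    · exact ENNReal.rpow_ne_top_of_nonneg hq1.le hItop

/-- The dual form of the Carleson embedding theorem. -/
theorem IsCarlesonFamily.lintegral_tsum_indicator_rpow_le [SFinite μ] [Countable ι]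
    (h : IsCarlesonFamily μ B A)
    (hB : ∀ i, MeasurableSet (B i)) (hfin : ∀ i, μ (B i) ≠ ∞) {q : ℝ} (hq : 1 < q)
    {a : ι → ℝ≥0∞} (ha : ∀ i, a i ≠ ∞) :
    ∫⁻ x, (∑' i, (B i).indicator (fun _ => a i) x) ^ q ∂μ ≤
      (A * ENNReal.ofReal (2 ^ (q / (q - 1)) * q)) ^ (q - 1) * ∑' i, a i ^ q * μ (B i) := by
  have hq0 : 0 < q := by linarith
  have hsup : ∀ x, (∑' i, (B i).indicator (fun _ => a i) x) ^ q =
      ⨆ s : Finset ι, (∑ i ∈ s, (B i).indicator (fun _ => a i) x) ^ q := by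
    intro x
    rw [ENNReal.tsum_eq_iSup_sum]
    exact (ENNReal.orderIsoRpow q hq0).map_iSup _
  simp_rw [hsup]
  rw [lintegral_iSup_directed]
  · refine iSup_le fun s => (h.lintegral_sum_indicator_rpow_le hB hfin hq ha s).trans ?_
    gcongr
    exact ENNReal.sum_le_tsum s
  · intro s
    exact ((Finset.measurable_fun_sum s fun i _ =>
      measurable_const.indicator (hB i)).pow_const _).aemeasurable
  · refine Monotone.directed_le fun s t hst x => ?_
    dsimp only
    gcongr

end Carleson

/-- A nested sequence of partitions of a set `Q`, given by index maps, whose generation `k` cells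
all have measure `V k`. -/
structure DyadicGrid (X J : Type*) [MeasurableSpace X] (ν : Measure X) where
  Q : Set X
  idx : ℕ → X → J
  V : ℕ → ℝ≥0∞
  Λ : ℝ≥0∞
  idx_zero : ∀ x ∈ Q, ∀ y ∈ Q, idx 0 x = idx 0 y
  idx_succ : ∀ k, ∀ x ∈ Q, ∀ y ∈ Q, idx (k + 1) x = idx (k + 1) y → idx k x = idx k y
  measurableSet_cell : ∀ k j, MeasurableSet {y ∈ Q | idx k y = j}
  measure_cell : ∀ k, ∀ x ∈ Q, ν {y ∈ Q | idx k y = idx k x} = V k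
  V_ne_zero : ∀ k, V k ≠ 0
  V_ne_top : ∀ k, V k ≠ ∞
  V_le : ∀ k, V k ≤ Λ * V (k + 1)
  one_le_Λ : 1 ≤ Λ

lemma measure_biUnion_le_of_finset {X ι : Type*} [MeasurableSpace X] {μ : Measure X}
    {B : ι → Set X} {T : Set ι} (hT : T.Countable) {c : ℝ≥0∞}
    (h : ∀ s : Finset ι, (s : Set ι) ⊆ T → μ (⋃ i ∈ s, B i) ≤ c) :
    μ (⋃ i ∈ T, B i) ≤ c := by
  classical
  have := hT.to_subtype
  rw [biUnion_eq_iUnion, iUnion_eq_iUnion_finset, Directed.measure_iUnion]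
  · refine iSup_le fun s => ?_
    refine le_trans (measure_mono ?_) (h (s.map (Function.Embedding.subtype _)) ?_)
    · intro x hx
      simp only [mem_iUnion] at hx ⊢
      obtain ⟨i, hi, hx⟩ := hx
      exact ⟨i, Finset.mem_map.mpr ⟨i, hi, rfl⟩, hx⟩
    · intro i hi
      obtain ⟨j, _, rfl⟩ := Finset.mem_map.mp (Finset.mem_coe.mp hi)
      exact j.2
  · refine Monotone.directed_le fun s t hst => ?_
    exact biUnion_subset_biUnion_left fun i hi => hst hi

namespace DyadicGrid

variable {X J : Type*} [MeasurableSpace X] {ν : Measure X} (G : DyadicGrid X J ν)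

/-- The cell of generation `i.1` with index `i.2`. -/
def cell (i : ℕ × J) : Set X := {y ∈ G.Q | G.idx i.1 y = i.2}

/-- The `ν`-average of `f` over the cell `i`. -/
def avg (f : X → ℝ≥0∞) (i : ℕ × J) : ℝ≥0∞ := (G.V i.1)⁻¹ * ∫⁻ x in G.cell i, f x ∂ν

/-- The generation `k` cell containing `x` is a stopping cell if the averages of `f` over it and
over each of its strict ancestors are separated by one of the thresholds `a ^ l` times the average
over the whole grid. -/
def Stop (f : X → ℝ≥0∞) (a : ℝ≥0∞) (k : ℕ) (x : X) : Prop :=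
  ∀ i < k, ∃ l : ℕ, G.avg f (i, G.idx i x) ≤ G.avg f (0, G.idx 0 x) * a ^ (l + 1) ∧
    G.avg f (0, G.idx 0 x) * a ^ (l + 1) < G.avg f (k, G.idx k x)

/-- The index set of all stopping cells. -/
def stopSet (f : X → ℝ≥0∞) (a : ℝ≥0∞) : Set (ℕ × J) :=
  {i | ∃ x ∈ G.cell i, G.Stop f a i.1 x}

variable {G}

lemma measurableSet_cell' (i : ℕ × J) : MeasurableSet (G.cell i) := G.measurableSet_cell i.1 i.2

lemma cell_subset (i : ℕ × J) : G.cell i ⊆ G.Q := fun _ h => h.1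

lemma measure_cell_of_mem {i : ℕ × J} {x : X} (hx : x ∈ G.cell i) : ν (G.cell i) = G.V i.1 := by
  have := G.measure_cell i.1 x hx.1
  rwa [hx.2] at this

lemma idx_eq_of_le {i k : ℕ} (hik : i ≤ k) {x y : X} (hx : x ∈ G.Q) (hy : y ∈ G.Q)
    (h : G.idx k x = G.idx k y) : G.idx i x = G.idx i y := by
  induction k, hik using Nat.le_induction with
  | base => exact h
  | succ k _ ih => exact ih (G.idx_succ k x hx y hy h)

lemma cell_subset_cell {i i' : ℕ × J} (h : i.1 ≤ i'.1) {x : X} (hx : x ∈ G.cell i)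
    (hx' : x ∈ G.cell i') : G.cell i' ⊆ G.cell i := fun _ hy =>
  ⟨hy.1, (idx_eq_of_le h hy.1 hx.1 (hy.2.trans hx'.2.symm)).trans hx.2⟩

lemma cell_zero {x : X} (hx : x ∈ G.Q) : G.cell (0, G.idx 0 x) = G.Q :=
  Subset.antisymm (cell_subset _) fun y hy => ⟨hy, G.idx_zero y hy x hx⟩

lemma stop_congr {f : X → ℝ≥0∞} {a : ℝ≥0∞} {k : ℕ} {x y : X} (hx : x ∈ G.Q) (hy : y ∈ G.Q)
    (h : G.idx k x = G.idx k y) (hs : G.Stop f a k x) : G.Stop f a k y := by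
  intro i hi
  have := hs i hi
  rwa [idx_eq_of_le hi.le hx hy h, h, idx_eq_of_le (Nat.zero_le k) hx hy h] at this

/-- Among finitely many cells, the maximal ones are disjoint and have the same union. -/
lemma exists_disjoint_subfamily (s : Finset (ℕ × J)) :
    ∃ t ⊆ s, (t : Set (ℕ × J)).PairwiseDisjoint G.cell ∧
      (⋃ i ∈ s, G.cell i) = ⋃ i ∈ t, G.cell i := by
  classical
  refine ⟨s.filter fun i => ∀ i' ∈ s, i'.1 < i.1 → Disjoint (G.cell i) (G.cell i'),
    Finset.filter_subset _ _, ?_, ?_⟩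
  · intro i hi i' hi' hne
    simp only [Finset.coe_filter, mem_ofPred_eq] at hi hi'
    rcases lt_trichotomy i.1 i'.1 with h | h | h
    · exact (hi'.2 i hi.1 h).symm
    · refine Set.disjoint_left.mpr fun x hx hx' => hne (Prod.ext h ?_)
      rw [← hx.2, ← hx'.2, h]
    · exact hi.2 i' hi'.1 h
  · refine Subset.antisymm (fun x hx => ?_) ?_
    · simp only [mem_iUnion, exists_prop] at hx ⊢
      have hne : (s.filter fun i => x ∈ G.cell i).Nonempty := by
        obtain ⟨i, hi, hxi⟩ := hx
        exact ⟨i, Finset.mem_filter.mpr ⟨hi, hxi⟩⟩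
      obtain ⟨i, hi, hmin⟩ := Finset.exists_min_image _ (fun i : ℕ × J => i.1) hne
      rw [Finset.mem_filter] at hi
      refine ⟨i, Finset.mem_filter.mpr ⟨hi.1, fun i' hi' hlt => ?_⟩, hi.2⟩
      refine Set.disjoint_left.mpr fun y hy hy' => ?_
      have hx' : x ∈ G.cell i' := cell_subset_cell hlt.le hy' hy hi.2
      exact absurd (hmin i' (Finset.mem_filter.mpr ⟨hi', hx'⟩)) (not_le.mpr hlt)
    · exact biUnion_subset_biUnion_left fun i hi => (Finset.mem_filter.mp hi).1

lemma avg_le_succ (f : X → ℝ≥0∞) (k : ℕ) {x : X} (hx : x ∈ G.Q) :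
    G.avg f (k + 1, G.idx (k + 1) x) ≤ G.Λ * G.avg f (k, G.idx k x) := by
  have h1 : (G.V (k + 1))⁻¹ ≤ G.Λ * (G.V k)⁻¹ := by
    rw [← div_eq_mul_inv, ENNReal.le_div_iff_mul_le (Or.inl (G.V_ne_zero k))
      (Or.inl (G.V_ne_top k)), mul_comm, ← div_eq_mul_inv]
    exact ENNReal.div_le_of_le_mul (G.V_le k)
  calc G.avg f (k + 1, G.idx (k + 1) x)
      ≤ G.Λ * (G.V k)⁻¹ * ∫⁻ x in G.cell (k, G.idx k x), f x ∂ν := by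
        refine mul_le_mul' h1 (lintegral_mono_set ?_)
        exact cell_subset_cell (i := (k, G.idx k x)) (i' := (k + 1, G.idx (k + 1) x))
          (Nat.le_succ k) (x := x) ⟨hx, rfl⟩ ⟨hx, rfl⟩
    _ = _ := by rw [avg, mul_assoc]

lemma avg_ne_top {f : X → ℝ≥0∞} (hf : ∫⁻ x in G.Q, f x ∂ν ≠ ∞) (i : ℕ × J) :
    G.avg f i ≠ ∞ :=
  ENNReal.mul_ne_top (ENNReal.inv_ne_top.mpr (G.V_ne_zero _))
    (ne_top_of_le_ne_top hf (lintegral_mono_set (cell_subset i)))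

/-- Every average is controlled by the average over a stopping ancestor. -/
lemma exists_stopping {f : X → ℝ≥0∞} (hf : ∫⁻ x in G.Q, f x ∂ν ≠ ∞) {a : ℝ≥0∞} (ha : 1 < a)
    (k : ℕ) {x : X} (hx : x ∈ G.Q) :
    ∃ i ≤ k, G.Stop f a i x ∧ G.avg f (k, G.idx k x) ≤ a * G.avg f (i, G.idx i x) := by
  set m : ℕ → ℝ≥0∞ := fun i => G.avg f (i, G.idx i x) with hm
  rcases le_or_gt (m k) (m 0 * a) with h | h
  · exact ⟨0, Nat.zero_le k, fun i hi => absurd hi (Nat.not_lt_zero i), by rwa [mul_comm]⟩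
  have hm0 : m 0 ≠ 0 := by
    intro h0
    have hQ : ∫⁻ x in G.Q, f x ∂ν = 0 := by
      rw [hm] at h0
      simp only [avg, cell_zero hx, mul_eq_zero, ENNReal.inv_eq_zero] at h0
      exact h0.resolve_left (G.V_ne_top 0)
    have : m k = 0 := by
      simp only [hm, avg, mul_eq_zero]
      exact Or.inr (le_antisymm ((lintegral_mono_set (cell_subset _)).trans hQ.le) zero_le)
    rw [this] at h
    exact absurd h (not_lt.mpr zero_le)
  have hex : ∃ l : ℕ, m k ≤ m 0 * a ^ (l + 1) := by
    have ht : Filter.Tendsto (fun l : ℕ => m 0 * a ^ (l + 1)) Filter.atTop (nhds (m 0 * ∞)) := by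
      refine ENNReal.Tendsto.const_mul ?_ (Or.inl ENNReal.top_ne_zero)
      exact (ENNReal.tendsto_pow_atTop_nhds_top_iff.mpr ha).comp (Filter.tendsto_add_atTop_nat 1)
    rw [ENNReal.mul_top hm0] at ht
    obtain ⟨l, hl⟩ := (ht.eventually (lt_mem_nhds (avg_ne_top hf _).lt_top)).exists
    exact ⟨l, hl.le⟩
  classical
  obtain ⟨l, hl⟩ : ∃ l, Nat.find hex = l + 1 := by
    refine Nat.exists_eq_succ_of_ne_zero fun h0 => ?_
    have := Nat.find_spec hex
    rw [h0, zero_add, pow_one] at this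
    exact absurd h (not_lt.mpr this)
  have hlo : m 0 * a ^ (l + 1) < m k :=
    not_le.mp (Nat.find_min hex (m := l) (by omega))
  have hhi : m k ≤ m 0 * a ^ (l + 1 + 1) := by
    have := Nat.find_spec hex
    rwa [hl] at this
  have hex' : ∃ i, m 0 * a ^ (l + 1) < m i := ⟨k, hlo⟩
  refine ⟨Nat.find hex', Nat.find_min' hex' hlo, fun i hi => ⟨l, ?_, Nat.find_spec hex'⟩, ?_⟩
  · exact not_lt.mp (Nat.find_min hex' hi)
  · calc m k ≤ a * (m 0 * a ^ (l + 1)) := hhi.trans_eq (by ring)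
      _ ≤ _ := by
        gcongr
        exact (Nat.find_spec hex').le

/-- Averages over nested stopping cells increase geometrically. -/
lemma avg_lt_of_stopping {f : X → ℝ≥0∞} {a : ℝ≥0∞} (ha : 1 ≤ a) {k k' : ℕ} (hk : k < k') {x : X}
    (hx : x ∈ G.Q) (hs : G.Stop f a k x) (hs' : G.Stop f a k' x) :
    a * G.avg f (k, G.idx k x) ≤ G.Λ * G.avg f (k', G.idx k' x) ∧
      G.avg f (k', G.idx k' x) ≠ 0 := by
  obtain ⟨l', h1, h2⟩ := hs' k hk
  refine ⟨?_, (lt_of_le_of_lt zero_le h2).ne'⟩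
  set m : ℕ → ℝ≥0∞ := fun i => G.avg f (i, G.idx i x) with hm
  change a * m k ≤ G.Λ * m k'
  rcases Nat.eq_zero_or_pos k with rfl | hpos
  · calc a * m 0 ≤ m 0 * a ^ (l' + 1) := by
          rw [mul_comm]
          gcongr
          exact le_self_pow₀ ha (by omega)
      _ ≤ m k' := h2.le
      _ ≤ G.Λ * m k' := le_mul_of_one_le_left zero_le G.one_le_Λ
  · obtain ⟨k, rfl⟩ := Nat.exists_eq_succ_of_ne_zero hpos.ne'
    obtain ⟨l, h3, h4⟩ := hs k (Nat.lt_succ_self k)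
    have hll : l < l' := by
      by_contra hcon
      have : m 0 * a ^ (l' + 1) ≤ m 0 * a ^ (l + 1) := by
        gcongr
        omega
      exact absurd (h1.trans this) (not_le.mpr h4)
    calc a * m (k + 1) ≤ a * (G.Λ * m k) := by
          gcongr
          exact avg_le_succ f k hx
      _ ≤ a * (G.Λ * (m 0 * a ^ (l + 1))) := by gcongr
      _ = G.Λ * (m 0 * a ^ (l + 1 + 1)) := by ring
      _ ≤ G.Λ * (m 0 * a ^ (l' + 1)) := by
          gcongr
          omega
      _ ≤ _ := by gcongr

/-- The part of a cell covered by strictly later stopping cells. -/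
def laterStops (G : DyadicGrid X J ν) (f : X → ℝ≥0∞) (a : ℝ≥0∞) (i : ℕ × J) : Set X :=
  ⋃ i' ∈ {i' ∈ G.stopSet f a | i.1 < i'.1}, G.cell i ∩ G.cell i'

lemma measurableSet_laterStops [Countable J] (f : X → ℝ≥0∞) (a : ℝ≥0∞) (i : ℕ × J) :
    MeasurableSet (G.laterStops f a i) :=
  MeasurableSet.biUnion (Set.to_countable _) fun i' _ =>
    (measurableSet_cell' i).inter (measurableSet_cell' i')

lemma measure_laterStops_le [Countable J] {f : X → ℝ≥0∞} (hf : ∫⁻ x in G.Q, f x ∂ν ≠ ∞)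
    {a : ℝ≥0∞} (ha : 1 ≤ a) (ha' : a ≠ ∞) {i : ℕ × J} (hi : i ∈ G.stopSet f a) :
    ν (G.laterStops f a i) ≤ G.Λ / a * ν (G.cell i) := by
  classical
  obtain ⟨x, hx, hstopping⟩ := hi
  set T : Set (ℕ × J) := {i' | i' ∈ G.stopSet f a ∧ i.1 < i'.1 ∧ G.cell i' ⊆ G.cell i} with hT
  have hsub : G.laterStops f a i ⊆ ⋃ i' ∈ T, G.cell i' := by
    intro y hy
    simp only [laterStops, mem_iUnion, exists_prop] at hy
    obtain ⟨i', ⟨hi', hlt⟩, hyi, hyi'⟩ := hy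
    exact mem_biUnion ⟨hi', hlt, cell_subset_cell hlt.le hyi hyi'⟩ hyi'
  refine (measure_mono hsub).trans ?_
  have hbound : ∀ i' ∈ T, a * G.avg f i * ν (G.cell i') ≤ G.Λ * ∫⁻ x in G.cell i', f x ∂ν ∧
      ∫⁻ x in G.cell i', f x ∂ν ≠ 0 := by
    rintro i' ⟨⟨y, hy, hstopping'⟩, hlt, hsub⟩
    have hyi : y ∈ G.cell i := hsub hy
    have := avg_lt_of_stopping ha hlt hy.1
      (stop_congr hx.1 hy.1 (hx.2.trans hyi.2.symm) hstopping) hstopping'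
    rw [hyi.2, hy.2] at this
    obtain ⟨h1, h2⟩ := this
    rw [measure_cell_of_mem hy]
    refine ⟨?_, fun h0 => h2 (by simp [avg, h0])⟩
    calc a * G.avg f i * G.V i'.1 ≤ G.Λ * G.avg f i' * G.V i'.1 := by gcongr
      _ = G.Λ * ((G.V i'.1)⁻¹ * G.V i'.1) * ∫⁻ x in G.cell i', f x ∂ν := by
          rw [avg]; ring
      _ = _ := by rw [ENNReal.inv_mul_cancel (G.V_ne_zero _) (G.V_ne_top _), mul_one]
  rcases eq_or_ne (G.avg f i) 0 with h0 | h0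
  · have hintegrable : ∫⁻ x in G.cell i, f x ∂ν = 0 := by
      simp only [avg, mul_eq_zero, ENNReal.inv_eq_zero] at h0
      exact h0.resolve_left (G.V_ne_top _)
    have : T = ∅ := by
      refine eq_empty_of_forall_notMem fun i' hi' => (hbound i' hi').2 (le_antisymm ?_ zero_le)
      exact (lintegral_mono_set hi'.2.2).trans hintegrable.le
    simp [this]
  refine measure_biUnion_le_of_finset (Set.to_countable _) fun s hs => ?_
  obtain ⟨t, hts, hdisj, hunion⟩ := G.exists_disjoint_subfamily s
  have hVi := measure_cell_of_mem hx
  have hle : a * G.avg f i * ν (⋃ i' ∈ s, G.cell i') ≤ G.avg f i * (G.Λ * ν (G.cell i)) := by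
    calc a * G.avg f i * ν (⋃ i' ∈ s, G.cell i')
        ≤ a * G.avg f i * ∑ i' ∈ t, ν (G.cell i') := by
          rw [hunion]
          gcongr
          exact measure_biUnion_finset_le _ _
      _ ≤ ∑ i' ∈ t, G.Λ * ∫⁻ x in G.cell i', f x ∂ν := by
          rw [Finset.mul_sum]
          exact Finset.sum_le_sum fun i' hi' => (hbound i' (hs (hts hi'))).1
      _ = G.Λ * ∫⁻ x in ⋃ i' ∈ t, G.cell i', f x ∂ν := by
          rw [← Finset.mul_sum, lintegral_biUnion_finset hdisj fun i _ => measurableSet_cell' i]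
      _ ≤ G.Λ * ∫⁻ x in G.cell i, f x ∂ν := by
          gcongr
          exact iUnion₂_subset fun i' hi' => (hs (hts hi')).2.2
      _ = G.Λ * (G.V i.1 * (G.V i.1)⁻¹) * ∫⁻ x in G.cell i, f x ∂ν := by
          rw [ENNReal.mul_inv_cancel (G.V_ne_zero _) (G.V_ne_top _), mul_one]
      _ = _ := by
          rw [hVi, avg]
          ring
  rw [mul_comm a, mul_assoc] at hle
  have hle' := (ENNReal.mul_le_mul_iff_right h0 (avg_ne_top hf i)).mp hle
  rw [mul_comm, ← ENNReal.le_div_iff_mul_le (Or.inl (by positivity)) (Or.inl ha')] at hle'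
  rwa [ENNReal.mul_div_right_comm] at hle'

end DyadicGrid

lemma ENNReal.rpow_eq_self_mul_rpow_sub_one (x : ℝ≥0∞) {s : ℝ} (hs : 1 ≤ s) :
    x ^ s = x * x ^ (s - 1) := by
  conv_lhs => rw [show s = 1 + (s - 1) by ring]
  rw [ENNReal.rpow_add_of_nonneg _ _ zero_le_one (by linarith), ENNReal.rpow_one]

lemma ENNReal.tsum_rpow_le_rpow_tsum {ι : Type*} (x : ι → ℝ≥0∞) {s : ℝ} (hs : 1 ≤ s) :
    ∑' i, x i ^ s ≤ (∑' i, x i) ^ s := by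
  rw [ENNReal.rpow_eq_self_mul_rpow_sub_one _ hs, ← ENNReal.tsum_mul_right]
  refine ENNReal.tsum_le_tsum fun i => ?_
  rw [ENNReal.rpow_eq_self_mul_rpow_sub_one _ hs]
  gcongr
  exact ENNReal.le_tsum i

lemma measure_le_two_mul_sdiff {X : Type*} [MeasurableSpace X] {μ : Measure X} {A L : Set X}
    (hL : MeasurableSet L) (hLA : L ⊆ A) (hA : μ A ≠ ∞) (h : μ L ≤ 2⁻¹ * μ A) :
    μ A ≤ 2 * μ (A \ L) := by
  have h1 : μ (A \ L) + μ L = μ A := by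
    have h := measure_sdiff_add_inter (μ := μ) (s := A) hL
    rwa [inter_eq_right.mpr hLA] at h
  have h2 : 2⁻¹ * μ A + 2⁻¹ * μ A = μ A := by
    rw [← add_mul, ENNReal.inv_two_add_inv_two, one_mul]
  have h3 : 2⁻¹ * μ A ≤ μ (A \ L) := by
    rw [← ENNReal.add_le_add_iff_right (ENNReal.mul_ne_top (by simp : (2⁻¹ : ℝ≥0∞) ≠ ∞) hA), h2,
      ← h1]
    rw [← h1] at h
    gcongr
  calc μ A = 2 * (2⁻¹ * μ A) := by
        rw [← mul_assoc, ENNReal.mul_inv_cancel (by simp) (by simp), one_mul]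
    _ ≤ _ := by gcongr

namespace DyadicGrid

variable {X J : Type*} [MeasurableSpace X] {ν : Measure X} {G : DyadicGrid X J ν}

/-- Pointwise domination of the full dyadic sum by the sum over stopping cells. -/
lemma tsum_avg_le {f : X → ℝ≥0∞} (hf : ∫⁻ x in G.Q, f x ∂ν ≠ ∞) {a : ℝ≥0∞} (ha : 1 < a)
    {l : ℕ → ℝ≥0∞} (hl : ∀ i m, l (i + m) = l i * 2⁻¹ ^ m) {x : X} (hx : x ∈ G.Q) :
    ∑' k, l k * G.avg f (k, G.idx k x) ≤
      2 * a * ∑' i : G.stopSet f a, (G.cell i).indicator (fun _ => l i.1.1 * G.avg f i) x := by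
  classical
  choose i hik hstopping hle using fun k => exists_stopping hf ha k hx
  set c : ℕ → ℝ≥0∞ := fun k => if G.Stop f a k x then G.avg f (k, G.idx k x) else 0 with hc
  have h1 : ∀ k, l k * G.avg f (k, G.idx k x) ≤
      a * (l (i k + (k - i k)) * c (i k)) := by
    intro k
    rw [Nat.add_sub_cancel' (hik k), hc]
    simp only [hstopping k, if_true]
    calc _ ≤ l k * (a * G.avg f (i k, G.idx (i k) x)) := by gcongr; exact hle k
      _ = _ := by ring
  have hinj : Function.Injective fun k : ℕ => ((i k, k - i k) : ℕ × ℕ) := by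
    intro k k' h
    simp only [Prod.mk.injEq] at h
    have := hik k
    have := hik k'
    omega
  calc ∑' k, l k * G.avg f (k, G.idx k x)
      ≤ ∑' k, a * (l (i k + (k - i k)) * c (i k)) := ENNReal.tsum_le_tsum h1
    _ ≤ a * ∑' z : ℕ × ℕ, l (z.1 + z.2) * c z.1 := by
        rw [ENNReal.tsum_mul_left]
        gcongr
        exact ENNReal.tsum_comp_le_tsum_of_injective hinj
          fun z : ℕ × ℕ => l (z.1 + z.2) * c z.1
    _ = a * ∑' k, ∑' m : ℕ, 2⁻¹ ^ m * (l k * c k) := by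
        rw [ENNReal.tsum_prod (f := fun k m => l (k + m) * c k)]
        congr 3
        ext k
        congr 1
        ext m
        rw [hl]
        ring
    _ = 2 * a * ∑' k, l k * c k := by
        simp_rw [ENNReal.tsum_mul_right, ENNReal.tsum_geometric, ENNReal.one_sub_inv_two, inv_inv]
        rw [ENNReal.tsum_mul_left]
        ring
    _ ≤ _ := by
        gcongr
        have h2 : ∑' k, l k * c k =
            ∑' k : {k | G.Stop f a k x}, l k * G.avg f (k, G.idx k x) := by
          rw [tsum_subtype {k | G.Stop f a k x} fun k => l k * G.avg f (k, G.idx k x)]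
          congr 1
          ext k
          simp only [hc, indicator, mem_ofPred_eq]
          split_ifs <;> simp
        let φ : {k | G.Stop f a k x} → G.stopSet f a := fun k =>
          ⟨(k.1, G.idx k x), x, ⟨hx, rfl⟩, k.2⟩
        have hφ : Function.Injective φ := by
          intro k k' h
          have := congrArg (fun z : G.stopSet f a => z.1.1) h
          exact Subtype.ext this
        rw [h2]
        refine le_trans (ENNReal.tsum_le_tsum fun k => ?_)
          (ENNReal.tsum_comp_le_tsum_of_injective hφ _)
        have : x ∈ G.cell (φ k) := ⟨hx, rfl⟩
        rw [indicator_of_mem this]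

lemma isCarlesonFamily_stopSet [Countable J] {μ : Measure X} (hμ : μ G.Q ≠ ∞)
    {f : X → ℝ≥0∞} (hf : ∫⁻ x in G.Q, f x ∂ν ≠ ∞) {a : ℝ≥0∞} (ha : 1 ≤ a) (ha' : a ≠ ∞)
    (hA : ∀ i, (G.cell i).Nonempty → ∀ E, MeasurableSet E → E ⊆ G.cell i →
      ν E ≤ G.Λ / a * ν (G.cell i) → μ E ≤ 2⁻¹ * μ (G.cell i)) :
    IsCarlesonFamily μ (fun i : G.stopSet f a => G.cell i) 2 := by
  classical
  rw [← mul_one (2 : ℝ≥0∞)]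
  have hlater : ∀ i, G.laterStops f a i ⊆ G.cell i := fun i =>
    iUnion₂_subset fun _ _ => inter_subset_left
  have hLm : ∀ i, MeasurableSet (G.laterStops f a i) := measurableSet_laterStops f a
  refine isCarlesonFamily_of_sparse (E := fun i : G.stopSet f a => G.cell i \ G.laterStops f a i)
    (fun i => (measurableSet_cell' _).diff (hLm i))
    (fun i => sdiff_subset) ?_ ?_ ?_
  · intro i i' hne
    have hlt : ∀ i i' : G.stopSet f a, i.1.1 < i'.1.1 →
        Disjoint (G.cell i \ G.laterStops f a i) (G.cell i' \ G.laterStops f a i') := by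
      intro i i' h
      refine Set.disjoint_left.mpr fun x hx hx' => hx.2 ?_
      exact mem_biUnion (show i'.1 ∈ {i' ∈ G.stopSet f a | i.1.1 < i'.1} from ⟨i'.2, h⟩)
        ⟨hx.1, hx'.1⟩
    rcases lt_trichotomy i.1.1 i'.1.1 with h | h | h
    · exact hlt i i' h
    · refine Set.disjoint_left.mpr fun x hx hx' => hne (Subtype.ext (Prod.ext h ?_))
      rw [← hx.1.2, ← hx'.1.2, h]
    · exact (hlt i' i h).symm
  · intro i
    have hne : (G.cell i).Nonempty := by
      obtain ⟨x, hx, _⟩ := i.2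
      exact ⟨x, hx⟩
    exact measure_le_two_mul_sdiff (hLm i) (hlater i)
      (ne_top_of_le_ne_top hμ (measure_mono (cell_subset _)))
      (hA i hne _ (hLm i) (hlater i)
        (measure_laterStops_le hf ha ha' i.2))
  · intro s
    obtain ⟨t, hts, hdisj, hunion⟩ :=
      G.exists_disjoint_subfamily (s.map (Function.Embedding.subtype _))
    refine ⟨s.filter fun i => i.1 ∈ t, Finset.filter_subset _ _, ?_, ?_⟩
    · intro i hi i' hi' hne
      simp only [Finset.coe_filter, mem_ofPred_eq] at hi hi'
      exact hdisj hi.2 hi'.2 fun h => hne (Subtype.ext h)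
    · have h1 : (⋃ i ∈ s, G.cell i.1) = ⋃ i ∈ s.filter fun i => i.1 ∈ t, G.cell i.1 := by
        refine Subset.antisymm (fun x hx => ?_)
          (biUnion_subset_biUnion_left fun i hi => (Finset.mem_filter.mp hi).1)
        have hx' : x ∈ ⋃ i ∈ t, G.cell i := by
          rw [← hunion]
          simp only [mem_iUnion, exists_prop] at hx ⊢
          obtain ⟨i, hi, hx⟩ := hx
          exact ⟨i, Finset.mem_map.mpr ⟨i, hi, rfl⟩, hx⟩
        simp only [mem_iUnion, exists_prop] at hx' ⊢
        obtain ⟨i, hi, hx⟩ := hx'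
        obtain ⟨j, hj, rfl⟩ := Finset.mem_map.mp (hts hi)
        exact ⟨j, Finset.mem_filter.mpr ⟨hj, hi⟩, hx⟩
      rw [h1, one_mul]
      exact measure_biUnion_finset_le _ _

/-- The two-weight bound for the dyadic fractional integral operator. -/
theorem lintegral_tsum_avg_rpow_le [Countable J] {μ τ : Measure X} [SFinite μ] [SFinite τ]
    (hμ : μ G.Q ≠ ∞) (hτ : τ G.Q ≠ ∞) {p q : ℝ} (hp : 1 < p) (hpq : p ≤ q)
    {f h : X → ℝ≥0∞} (hh : Measurable h) (hf : ∫⁻ x in G.Q, f x ∂ν ≠ ∞)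
    (hfh : ∀ i, ∫⁻ x in G.cell i, f x ∂ν = ∫⁻ x in G.cell i, h x ∂τ)
    {l : ℕ → ℝ≥0∞} (hl : ∀ i m, l (i + m) = l i * 2⁻¹ ^ m) (hltop : ∀ k, l k ≠ ∞)
    {a : ℝ≥0∞} (ha : 1 < a) (ha' : a ≠ ∞)
    (hAμ : ∀ i, (G.cell i).Nonempty → ∀ E, MeasurableSet E → E ⊆ G.cell i →
      ν E ≤ G.Λ / a * ν (G.cell i) → μ E ≤ 2⁻¹ * μ (G.cell i))
    (hAτ : ∀ i, (G.cell i).Nonempty → ∀ E, MeasurableSet E → E ⊆ G.cell i →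
      ν E ≤ G.Λ / a * ν (G.cell i) → τ E ≤ 2⁻¹ * τ (G.cell i))
    {K : ℝ≥0∞} (hK : ∀ i, (G.cell i).Nonempty →
      l i.1 * (G.V i.1)⁻¹ * μ (G.cell i) ^ (1 / q) * τ (G.cell i) ^ (1 - 1 / p) ≤ K) :
    ∫⁻ x in G.Q, (∑' k, l k * G.avg f (k, G.idx k x)) ^ q ∂μ ≤
      (2 * a) ^ q * ((2 * ENNReal.ofReal (2 ^ (q / (q - 1)) * q)) ^ (q - 1) *
        (K ^ q * (2 * ENNReal.ofReal (2 ^ p * (p / (p - 1))) * ∫⁻ x, h x ^ p ∂τ) ^ (q / p))) := by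
  have hp0 : 0 < p := by linarith
  have hq : 1 < q := by linarith
  have hq0 : 0 < q := by linarith
  have hCμ := isCarlesonFamily_stopSet hμ hf ha.le ha' hAμ
  have hCτ := isCarlesonFamily_stopSet hτ hf ha.le ha' hAτ
  have hmeas : ∀ i : G.stopSet f a, MeasurableSet (G.cell i) := fun i => measurableSet_cell' _
  have hμfin : ∀ i : ℕ × J, μ (G.cell i) ≠ ∞ := fun i =>
    ne_top_of_le_ne_top hμ (measure_mono (cell_subset _))
  have hτfin : ∀ i : ℕ × J, τ (G.cell i) ≠ ∞ := fun i =>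
    ne_top_of_le_ne_top hτ (measure_mono (cell_subset _))
  set F : X → ℝ≥0∞ := fun x =>
    ∑' i : G.stopSet f a, (G.cell i).indicator (fun _ => l i.1.1 * G.avg f i) x with hF
  have hFm : Measurable F := Measurable.tsum fun i => measurable_const.indicator (hmeas i)
  have hterm : ∀ i : G.stopSet f a, (l i.1.1 * G.avg f i) ^ q * μ (G.cell i) ≤
      K ^ q * (τ (G.cell i) * ((τ (G.cell i))⁻¹ * ∫⁻ x in G.cell i, h x ∂τ) ^ p) ^ (q / p) := by
    intro i
    have hne : (G.cell i).Nonempty := by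
      obtain ⟨x, hx, _⟩ := i.2
      exact ⟨x, hx⟩
    set m := (τ (G.cell i))⁻¹ * ∫⁻ x in G.cell i, h x ∂τ with hm
    have h1 : ∫⁻ x in G.cell i, h x ∂τ =
        τ (G.cell i) ^ (1 - 1 / p) * τ (G.cell i) ^ (1 / p) * m := by
      rw [← ENNReal.rpow_add_of_nonneg _ _ (by rw [sub_nonneg, div_le_one hp0]; exact hp.le)
        (by positivity), sub_add_cancel, ENNReal.rpow_one]
      rcases eq_or_ne (τ (G.cell i)) 0 with h0 | h0
      · rw [h0, Measure.restrict_eq_zero.mpr h0]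
        simp
      · rw [hm, ← mul_assoc, ENNReal.mul_inv_cancel h0 (hτfin _), one_mul]
    calc (l i.1.1 * G.avg f i) ^ q * μ (G.cell i)
        = (l i.1.1 * G.avg f i * μ (G.cell i) ^ (1 / q)) ^ q := by
          rw [ENNReal.mul_rpow_of_nonneg _ (μ (G.cell i) ^ (1 / q)) hq0.le, ← ENNReal.rpow_mul,
            one_div_mul_cancel hq0.ne', ENNReal.rpow_one]
      _ = (l i.1.1 * (G.V i.1.1)⁻¹ * μ (G.cell i) ^ (1 / q) * τ (G.cell i) ^ (1 - 1 / p) *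
            (τ (G.cell i) ^ (1 / p) * m)) ^ q := by
          rw [avg, hfh, h1]
          ring_nf
      _ ≤ (K * (τ (G.cell i) ^ (1 / p) * m)) ^ q := by
          gcongr
          exact hK i hne
      _ = _ := by
          rw [ENNReal.mul_rpow_of_nonneg _ _ hq0.le, div_eq_mul_inv q p, mul_comm q p⁻¹,
            ENNReal.rpow_mul (τ (G.cell i) * m ^ p), ENNReal.mul_rpow_of_nonneg _ (m ^ p)
            (by positivity), ← ENNReal.rpow_mul m, mul_inv_cancel₀ hp0.ne', ENNReal.rpow_one,
            one_div]
  calc ∫⁻ x in G.Q, (∑' k, l k * G.avg f (k, G.idx k x)) ^ q ∂μ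
      ≤ ∫⁻ x in G.Q, (2 * a * F x) ^ q ∂μ := by
        have hQm : MeasurableSet G.Q ∨ G.Q = ∅ := by
          rcases G.Q.eq_empty_or_nonempty with h | ⟨x, hx⟩
          · exact Or.inr h
          · exact Or.inl (cell_zero hx ▸ measurableSet_cell' _)
        rcases hQm with hQm | hQe
        · refine setLIntegral_mono' hQm fun x hx => ?_
          gcongr
          exact tsum_avg_le hf ha hl hx
        · simp [hQe]
    _ ≤ ∫⁻ x, (2 * a * F x) ^ q ∂μ := setLIntegral_le_lintegral _ _
    _ = (2 * a) ^ q * ∫⁻ x, F x ^ q ∂μ := by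
        simp_rw [ENNReal.mul_rpow_of_nonneg _ (F _) hq0.le]
        rw [lintegral_const_mul _ (hFm.pow_const _)]
    _ ≤ (2 * a) ^ q * ((2 * ENNReal.ofReal (2 ^ (q / (q - 1)) * q)) ^ (q - 1) *
          ∑' i : G.stopSet f a, (l i.1.1 * G.avg f i) ^ q * μ (G.cell i)) := by
        gcongr
        exact hCμ.lintegral_tsum_indicator_rpow_le hmeas (fun i => hμfin _) hq
          fun i => ENNReal.mul_ne_top (hltop _) (avg_ne_top hf _)
    _ ≤ _ := by
        gcongr
        calc ∑' i : G.stopSet f a, (l i.1.1 * G.avg f i) ^ q * μ (G.cell i)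
            ≤ ∑' i : G.stopSet f a, K ^ q * (τ (G.cell i) *
                ((τ (G.cell i))⁻¹ * ∫⁻ x in G.cell i, h x ∂τ) ^ p) ^ (q / p) :=
              ENNReal.tsum_le_tsum hterm
          _ ≤ K ^ q * (∑' i : G.stopSet f a, τ (G.cell i) *
                ((τ (G.cell i))⁻¹ * ∫⁻ x in G.cell i, h x ∂τ) ^ p) ^ (q / p) := by
              rw [ENNReal.tsum_mul_left]
              gcongr
              exact ENNReal.tsum_rpow_le_rpow_tsum _ ((one_le_div hp0).mpr hpq)
          _ ≤ _ := by
              gcongr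
              exact hCτ.tsum_average_rpow_le hmeas (fun i => hτfin _) hh hp

end DyadicGrid

section Poincare

variable {E : Type*} [NormedAddCommGroup E] [NormedSpace ℝ E] [MeasurableSpace E] [BorelSpace E]
  [FiniteDimensional ℝ E] (μ : Measure E) [μ.IsAddHaarMeasure]

lemma lintegral_comp_add_smul_left {f : E → ℝ≥0∞} (hf : Measurable f) (b : E) {t : ℝ}
    (ht : t ≠ 0) :
    ∫⁻ y, f (b + t • y) ∂μ = ENNReal.ofReal |(t ^ Module.finrank ℝ E)⁻¹| * ∫⁻ y, f y ∂μ := by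
  have h1 : ∫⁻ y, f (b + t • y) ∂μ = ∫⁻ y, f (b + y) ∂(Measure.map (fun y => t • y) μ) :=
    (lintegral_map (f := fun y => f (b + y)) (hf.comp (measurable_const_add b))
      (measurable_const_smul t)).symm
  rw [h1, Measure.map_addHaar_smul μ ht, lintegral_smul_measure, lintegral_add_left_eq_self f b,
    smul_eq_mul]

lemma LipschitzWith.ae_ae_differentiableAt_segment {L : ℝ≥0} {u : E → ℝ} (hu : LipschitzWith L u)
    (x : E) : ∀ᵐ y ∂μ, ∀ᵐ t ∂(volume.restrict (Ioo (0 : ℝ) 1)),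
      DifferentiableAt ℝ u ((1 - t) • x + t • y) := by
  have hm : Measurable fun z : E × ℝ => (1 - z.2) • x + z.2 • z.1 := by fun_prop
  have hmeas : MeasurableSet {z : E × ℝ | DifferentiableAt ℝ u ((1 - z.2) • x + z.2 • z.1)} :=
    hm (measurableSet_of_differentiableAt ℝ u)
  rw [Measure.ae_ae_comm hmeas]
  filter_upwards [ae_restrict_mem measurableSet_Ioo] with t ht
  have hae := hu.ae_differentiableAt (μ := μ)
  rw [ae_iff] at hae ⊢
  have hset : {y | ¬DifferentiableAt ℝ u ((1 - t) • x + t • y)} =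
      (fun y => t • y) ⁻¹' ((fun y => (1 - t) • x + y) ⁻¹' {y | ¬DifferentiableAt ℝ u y}) := rfl
  rw [hset, Measure.addHaar_preimage_smul μ ht.1.ne', measure_preimage_add, hae, mul_zero]

/-- Along almost every segment, the oscillation of a Lipschitz function is controlled by the
line integral of its gradient. -/
lemma LipschitzWith.ae_edist_le_lintegral_segment {L : ℝ≥0} {u : E → ℝ} (hu : LipschitzWith L u)
    (x : E) : ∀ᵐ y ∂μ, edist (u x) (u y) ≤
      edist x y * ∫⁻ t in Ioo (0 : ℝ) 1, ‖fderiv ℝ u ((1 - t) • x + t • y)‖ₑ := by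
  filter_upwards [hu.ae_ae_differentiableAt_segment μ x] with y hy
  set φ : ℝ → ℝ := fun t => u ((1 - t) • x + t • y) with hφ
  have hline : LipschitzWith ‖y - x‖₊ fun t : ℝ => (1 - t) • x + t • y := by
    refine LipschitzWith.of_dist_le_mul fun s t => ?_
    have : (1 - s) • x + s • y - ((1 - t) • x + t • y) = (s - t) • (y - x) := by module
    rw [dist_eq_norm, this, norm_smul, mul_comm, dist_eq_norm, coe_nnnorm]
  have hFTC := ((hu.comp hline).lipschitzOnWith
    (s := uIcc (0 : ℝ) 1)).absolutelyContinuousOnInterval.integral_deriv_eq_sub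
  have h0 : (u ∘ fun t : ℝ => (1 - t) • x + t • y) 1 -
      (u ∘ fun t : ℝ => (1 - t) • x + t • y) 0 = u y - u x := by simp
  rw [h0, intervalIntegral.integral_of_le zero_le_one, integral_Ioc_eq_integral_Ioo] at hFTC
  rw [edist_comm, edist_eq_enorm_sub, ← hFTC]
  refine (enorm_integral_le_lintegral_enorm _).trans ?_
  rw [← lintegral_const_mul' _ _ (edist_ne_top _ _)]
  refine lintegral_mono_ae ?_
  filter_upwards [hy] with t ht
  have hd : HasDerivAt (fun t : ℝ => (1 - t) • x + t • y) (y - x) t := by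
    have h1 : HasDerivAt (fun t : ℝ => (1 - t) • x) ((-1 : ℝ) • x) t :=
      ((hasDerivAt_id t).const_sub 1).smul_const x
    have h2 : HasDerivAt (fun t : ℝ => t • y) ((1 : ℝ) • y) t := (hasDerivAt_id t).smul_const y
    have h3 := h1.add h2
    rwa [show (-1 : ℝ) • x + (1 : ℝ) • y = y - x by module] at h3
  rw [(ht.hasFDerivAt.comp_hasDerivAt t hd).deriv, mul_comm, edist_comm, edist_eq_enorm_sub]
  exact ContinuousLinearMap.le_opENorm _ _

/-- The averaged Poincaré inequality on a convex set. -/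
lemma LipschitzWith.lintegral_lintegral_edist_le {L : ℝ≥0} {u : E → ℝ} (hu : LipschitzWith L u)
    {R : Set E} (hR : Convex ℝ R) (hRm : MeasurableSet R) {d : ℝ≥0∞}
    (hd : ∀ x ∈ R, ∀ y ∈ R, edist x y ≤ d) (hdtop : d ≠ ∞) :
    ∫⁻ x in R, ∫⁻ y in R, edist (u x) (u y) ∂μ ∂μ ≤
      d * (2 ^ Module.finrank ℝ E * μ R * ∫⁻ x in R, ‖fderiv ℝ u x‖ₑ ∂μ) := by
  set g : E → ℝ≥0∞ := fun x => ‖fderiv ℝ u x‖ₑ with hg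
  have hgm : Measurable g := (measurable_fderiv ℝ u).enorm
  set M := ∫⁻ x in R, g x ∂μ with hM
  have hhalf : ∀ t ∈ Icc (1 / 2 : ℝ) 1, ∀ x ∈ R,
      ∫⁻ y in R, g ((1 - t) • x + t • y) ∂μ ≤ 2 ^ Module.finrank ℝ E * M := by
    intro t ht x hx
    have ht0 : 0 < t := by linarith [ht.1]
    calc ∫⁻ y in R, g ((1 - t) • x + t • y) ∂μ
        ≤ ∫⁻ y, R.indicator g ((1 - t) • x + t • y) ∂μ := by
          rw [← lintegral_indicator hRm]
          refine lintegral_mono fun y => ?_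
          by_cases hy : y ∈ R
          · rw [indicator_of_mem hy, indicator_of_mem
              (hR hx hy (by linarith [ht.2]) ht0.le (by ring))]
          · rw [indicator_of_notMem hy]
            exact zero_le
      _ = ENNReal.ofReal |(t ^ Module.finrank ℝ E)⁻¹| * M := by
          rw [lintegral_comp_add_smul_left μ (hgm.indicator hRm) _ ht0.ne',
            lintegral_indicator hRm]
      _ ≤ _ := by
          gcongr
          rw [abs_of_pos (by positivity), ← inv_pow, ENNReal.ofReal_pow (by positivity)]
          gcongr
          rw [← ENNReal.ofReal_ofNat 2]
          refine ENNReal.ofReal_le_ofReal ?_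
          rw [inv_le_comm₀ ht0 (by norm_num)]
          simpa using ht.1
  have hslice : ∀ t ∈ Ioo (0 : ℝ) 1, ∫⁻ x in R, ∫⁻ y in R, g ((1 - t) • x + t • y) ∂μ ∂μ ≤
      2 ^ Module.finrank ℝ E * μ R * M := by
    intro t ht
    have hconst : ∫⁻ _ in R, 2 ^ Module.finrank ℝ E * M ∂μ =
        2 ^ Module.finrank ℝ E * μ R * M := by
      rw [setLIntegral_const]
      ring
    rw [← hconst]
    rcases le_total (1 / 2) t with h | h
    · exact setLIntegral_mono' hRm fun x hx => hhalf t ⟨h, ht.2.le⟩ x hx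
    · have hm : Measurable (Function.uncurry fun x y : E => g ((1 - t) • x + t • y)) :=
        hgm.comp (by fun_prop)
      rw [lintegral_lintegral_swap hm.aemeasurable]
      refine setLIntegral_mono' hRm fun y hy => ?_
      have := hhalf (1 - t) ⟨by linarith, by linarith [ht.1]⟩ y hy
      simpa [add_comm] using this
  have hm3 : Measurable fun z : (E × ℝ) × E => g ((1 - z.1.2) • z.1.1 + z.1.2 • z.2) :=
    hgm.comp (by fun_prop)
  calc ∫⁻ x in R, ∫⁻ y in R, edist (u x) (u y) ∂μ ∂μ
      ≤ ∫⁻ x in R, ∫⁻ y in R, d * (∫⁻ t in Ioo (0 : ℝ) 1, g ((1 - t) • x + t • y)) ∂μ ∂μ := by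
        refine setLIntegral_mono' hRm fun x hx => lintegral_mono_ae ?_
        filter_upwards [ae_restrict_of_ae (hu.ae_edist_le_lintegral_segment μ x),
          ae_restrict_mem hRm] with y hy hyR
        refine hy.trans ?_
        gcongr
        exact hd x hx y hyR
    _ = d * ∫⁻ x in R, ∫⁻ t in Ioo (0 : ℝ) 1, ∫⁻ y in R, g ((1 - t) • x + t • y) ∂μ ∂volume ∂μ := by
        simp_rw [lintegral_const_mul' _ _ hdtop]
        congr 2
        ext x
        refine lintegral_lintegral_swap (Measurable.aemeasurable ?_)
        exact hm3.comp (f := fun z : E × ℝ => ((x, z.2), z.1)) (by fun_prop)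
    _ = d * ∫⁻ t in Ioo (0 : ℝ) 1, ∫⁻ x in R, ∫⁻ y in R, g ((1 - t) • x + t • y) ∂μ ∂μ := by
        congr 1
        exact lintegral_lintegral_swap
          (f := fun x t => ∫⁻ y in R, g ((1 - t) • x + t • y) ∂μ)
          (hm3.lintegral_prod_right').aemeasurable
    _ ≤ d * ∫⁻ t in Ioo (0 : ℝ) 1, 2 ^ Module.finrank ℝ E * μ R * M := by
        gcongr 1
        exact setLIntegral_mono' measurableSet_Ioo hslice
    _ = _ := by
        rw [setLIntegral_const]
        simp

variable {μ}

lemma edist_setAverage_le {X : Type*} [MeasurableSpace X] {ν : Measure X} {A : Set X}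
    (hA0 : ν A ≠ 0) (hA : ν A ≠ ∞) {u : X → ℝ} (hu : IntegrableOn u A ν) (c : ℝ) :
    edist (⨍ x in A, u x ∂ν) c ≤ (ν A)⁻¹ * ∫⁻ x in A, edist (u x) c ∂ν := by
  have hfin : IsFiniteMeasure (ν.restrict A) := ⟨by simpa using hA.lt_top⟩
  have h1 : ⨍ x in A, u x ∂ν - c = (ν.real A)⁻¹ • ∫ x in A, (u x - c) ∂ν := by
    rw [integral_sub hu (integrable_const c), setAverage_eq, integral_const, smul_sub,
      measureReal_restrict_apply_univ, smul_smul, inv_mul_cancel₀, one_smul]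
    exact (ENNReal.toReal_pos hA0 hA).ne'
  rw [edist_eq_enorm_sub, h1, enorm_smul]
  have h2 : ‖(ν.real A)⁻¹‖ₑ = (ν A)⁻¹ := by
    rw [Real.enorm_of_nonneg (by positivity), Measure.real, ENNReal.ofReal_inv_of_pos
      (ENNReal.toReal_pos hA0 hA), ENNReal.ofReal_toReal hA]
  rw [h2]
  gcongr
  simp_rw [edist_eq_enorm_sub]
  exact enorm_integral_le_lintegral_enorm _

lemma edist_setAverage_setAverage_le {X : Type*} [MeasurableSpace X] {ν : Measure X} {A B : Set X}
    (hA0 : ν A ≠ 0) (hA : ν A ≠ ∞) (hB0 : ν B ≠ 0) (hB : ν B ≠ ∞) {u : X → ℝ}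
    (huA : IntegrableOn u A ν) (huB : IntegrableOn u B ν) :
    edist (⨍ x in A, u x ∂ν) (⨍ x in B, u x ∂ν) ≤
      (ν A)⁻¹ * ((ν B)⁻¹ * ∫⁻ x in A, ∫⁻ y in B, edist (u x) (u y) ∂ν ∂ν) := by
  refine (edist_setAverage_le hA0 hA huA _).trans ?_
  gcongr
  rw [← lintegral_const_mul' _ _ (ENNReal.inv_ne_top.mpr hB0)]
  refine lintegral_mono fun x => ?_
  dsimp only
  rw [edist_comm]
  refine (edist_setAverage_le hB0 hB huB _).trans_eq ?_
  simp_rw [edist_comm]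

/-- The oscillation of a Lipschitz function in a dyadic grid with convex cells is dominated by
the dyadic fractional integral of its gradient. -/
theorem DyadicGrid.edist_setAverage_le_tsum {J : Type*} (G : DyadicGrid E J μ)
    (hconv : ∀ i, Convex ℝ (G.cell i)) {l : ℕ → ℝ≥0∞} {A : ℝ≥0∞} (hA : A ≠ ∞)
    (hltop : ∀ k, l k ≠ ∞) (hl : Filter.Tendsto l Filter.atTop (nhds 0))
    (hdiam : ∀ i, ∀ x ∈ G.cell i, ∀ y ∈ G.cell i, edist x y ≤ A * l i.1)
    {L : ℝ≥0} {u : E → ℝ} (hu : LipschitzWith L u) {y : E} (hy : y ∈ G.Q) :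
    edist (⨍ x in G.Q, u x ∂μ) (u y) ≤
      2 ^ Module.finrank ℝ E * A * G.Λ *
        ∑' k, l k * G.avg (fun x => ‖fderiv ℝ u x‖ₑ) (k, G.idx k y) := by
  set R : ℕ → Set E := fun k => G.cell (k, G.idx k y) with hR
  have hyR : ∀ k, y ∈ R k := fun k => ⟨hy, rfl⟩
  have hV : ∀ k, μ (R k) = G.V k := fun k => measure_cell_of_mem (i := (k, _)) (hyR k)
  have hV0 : ∀ k, μ (R k) ≠ 0 := fun k => by rw [hV]; exact G.V_ne_zero k
  have hVt : ∀ k, μ (R k) ≠ ∞ := fun k => by rw [hV]; exact G.V_ne_top k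
  have hRm : ∀ k, MeasurableSet (R k) := fun k => measurableSet_cell' _
  have hbound : ∀ k, ∀ x ∈ R k, edist (u x) (u y) ≤ L * (A * l k) := fun k x hx =>
    (hu.edist_le_mul x y).trans (by gcongr; exact hdiam _ x hx y (hyR k))
  have hintegrable : ∀ k, IntegrableOn u (R k) μ := by
    intro k
    refine IntegrableOn.of_bound (hVt k).lt_top hu.continuous.aestronglyMeasurable
      (|u y| + (L * (A * l k)).toReal) ?_
    filter_upwards [ae_restrict_mem (hRm k)] with x hx
    have h1 : dist (u x) (u y) ≤ (L * (A * l k)).toReal := by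
      rw [dist_edist]
      exact ENNReal.toReal_mono (ENNReal.mul_ne_top ENNReal.coe_ne_top
        (ENNReal.mul_ne_top hA (hltop k))) (hbound k x hx)
    rw [Real.dist_eq] at h1
    rw [Real.norm_eq_abs]
    calc |u x| = |u y + (u x - u y)| := by ring_nf
      _ ≤ _ := (abs_add_le _ _).trans (by gcongr)
  have hQ : R 0 = G.Q := cell_zero hy
  rw [← hQ, ← ENNReal.tsum_mul_left]
  refine edist_le_tsum_of_edist_le_of_tendsto₀ (f := fun k => ⨍ x in R k, u x ∂μ) _ ?_ ?_
  · intro k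
    rw [edist_comm]
    refine (edist_setAverage_setAverage_le (hV0 _) (hVt _) (hV0 _) (hVt _) (hintegrable _)
      (hintegrable _)).trans ?_
    have hsub : R (k + 1) ⊆ R k := cell_subset_cell (i := (k, _)) (i' := (k + 1, _)) (Nat.le_succ k)
      (hyR k) (hyR (k + 1))
    calc (μ (R (k + 1)))⁻¹ *
          ((μ (R k))⁻¹ * ∫⁻ x in R (k + 1), ∫⁻ y in R k, edist (u x) (u y) ∂μ ∂μ)
        ≤ (μ (R (k + 1)))⁻¹ * ((μ (R k))⁻¹ * (A * l k * (2 ^ Module.finrank ℝ E * μ (R k) *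
            ∫⁻ x in R k, ‖fderiv ℝ u x‖ₑ ∂μ))) := by
          gcongr
          exact (lintegral_mono_set hsub).trans (hu.lintegral_lintegral_edist_le μ (hconv _)
            (hRm k) (hdiam _) (ENNReal.mul_ne_top hA (hltop k)))
      _ = (μ (R (k + 1)))⁻¹ * (μ (R k) * (μ (R k))⁻¹) * (A * l k * (2 ^ Module.finrank ℝ E *
            ∫⁻ x in R k, ‖fderiv ℝ u x‖ₑ ∂μ)) := by ring
      _ ≤ G.Λ * (μ (R k))⁻¹ * (A * l k * (2 ^ Module.finrank ℝ E *
            ∫⁻ x in R k, ‖fderiv ℝ u x‖ₑ ∂μ)) := by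
          rw [ENNReal.mul_inv_cancel (hV0 k) (hVt k), mul_one]
          gcongr
          rw [hV, hV]
          calc (G.V (k + 1))⁻¹ = (G.V (k + 1))⁻¹ * (G.V k * (G.V k)⁻¹) := by
                rw [ENNReal.mul_inv_cancel (G.V_ne_zero k) (G.V_ne_top k), mul_one]
            _ ≤ (G.V (k + 1))⁻¹ * (G.Λ * G.V (k + 1) * (G.V k)⁻¹) := by
                gcongr
                exact G.V_le k
            _ = (G.V (k + 1))⁻¹ * G.V (k + 1) * (G.Λ * (G.V k)⁻¹) := by ring
            _ = _ := by
                rw [ENNReal.inv_mul_cancel (G.V_ne_zero _) (G.V_ne_top _), one_mul]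
      _ = _ := by
          rw [hV, avg]
          ring
  · rw [tendsto_iff_edist_tendsto_0]
    have hlim : Filter.Tendsto (fun k => L * (A * l k)) Filter.atTop (nhds 0) := by
      have := ENNReal.Tendsto.const_mul (a := L * A) hl
        (Or.inr (ENNReal.mul_ne_top ENNReal.coe_ne_top hA))
      simpa [mul_assoc] using this
    refine tendsto_of_tendsto_of_tendsto_of_le_of_le tendsto_const_nhds hlim
      (fun _ => zero_le) fun k => ?_
    refine (edist_setAverage_le (hV0 k) (hVt k) (hintegrable k) _).trans ?_
    calc (μ (R k))⁻¹ * ∫⁻ x in R k, edist (u x) (u y) ∂μ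
        ≤ (μ (R k))⁻¹ * ∫⁻ x in R k, L * (A * l k) ∂μ := by
          gcongr 1
          exact setLIntegral_mono' (hRm k) (hbound k)
      _ = _ := by
          rw [setLIntegral_const, mul_left_comm, ENNReal.inv_mul_cancel (hV0 k) (hVt k), mul_one]

end Poincare

section Cubes

variable {n : ℕ}

lemma box_eq_preimage (a b : Fin n → ℝ) : {y : Rn n | ∀ i, a i ≤ y i ∧ y i < b i} =
    WithLp.ofLp ⁻¹' (Set.univ.pi fun i => Set.Ico (a i) (b i)) := by
  ext y
  simp

lemma measurableSet_box (a b : Fin n → ℝ) :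
    MeasurableSet {y : Rn n | ∀ i, a i ≤ y i ∧ y i < b i} := by
  rw [box_eq_preimage]
  exact (PiLp.volume_preserving_ofLp (Fin n)).measurable
    (MeasurableSet.univ_pi fun i => measurableSet_Ico)

lemma volume_box (a b : Fin n → ℝ) :
    volume {y : Rn n | ∀ i, a i ≤ y i ∧ y i < b i} = ∏ i, ENNReal.ofReal (b i - a i) := by
  rw [box_eq_preimage, (PiLp.volume_preserving_ofLp (Fin n)).measure_preimage
    (MeasurableSet.univ_pi fun i => measurableSet_Ico).nullMeasurableSet, Real.volume_pi_Ico]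

lemma convex_box (a b : Fin n → ℝ) : Convex ℝ {y : Rn n | ∀ i, a i ≤ y i ∧ y i < b i} := by
  intro y hy z hz s t hs ht hst i
  exact convex_Ico (a i) (b i) (hy i) (hz i) hs ht hst

lemma dist_le_sqrt_mul {y z : Rn n} {d : ℝ} (hd : 0 ≤ d) (h : ∀ i, |y i - z i| ≤ d) :
    dist y z ≤ √n * d := by
  rw [EuclideanSpace.dist_eq]
  calc √(∑ i, dist (y i) (z i) ^ 2) ≤ √(∑ _i : Fin n, d ^ 2) := by
        gcongr with i
        exact h i
    _ = √n * d := by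
        rw [Finset.sum_const, Finset.card_univ, Fintype.card_fin, nsmul_eq_mul,
          Real.sqrt_mul (by positivity), Real.sqrt_sq hd]

lemma measurableSet_cubeC (x : Rn n) (r : ℝ) : MeasurableSet (CubeC x r) :=
  measurableSet_box (fun i => x i - r) fun i => x i + r

lemma convex_cubeC (x : Rn n) (r : ℝ) : Convex ℝ (CubeC x r) :=
  convex_box (fun i => x i - r) fun i => x i + r

lemma volume_cubeC (x : Rn n) (r : ℝ) : volume (CubeC x r) = ENNReal.ofReal (2 * r) ^ n := by
  rw [CubeC, volume_box (fun i => x i - r) fun i => x i + r]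
  simp only [add_sub_sub_cancel, Finset.prod_const, Finset.card_univ, Fintype.card_fin, two_mul]

lemma isDyadicSubC_self (x : Rn n) (r : ℝ) : IsDyadicSubC x r (CubeC x r) := by
  refine ⟨0, fun _ => 0, by simp, ?_⟩
  ext y
  simp only [CubeC, mem_ofPred_eq]
  refine forall_congr' fun i => ?_
  norm_num
  intro _
  rw [show x i - r + 2 * r = x i + r by ring]

/-- The index vector of the generation `k` dyadic subcube of `CubeC x r` containing `y`. -/
def dyadicIndex (x : Rn n) (r : ℝ) (k : ℕ) (y : Rn n) : Fin n → ℕ :=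
  fun i => ⌊2 ^ k * ((y i - x i + r) / (2 * r))⌋₊

lemma dyadicIndex_lt {x : Rn n} {r : ℝ} (hr : 0 < r) {k : ℕ} {y : Rn n} (hy : y ∈ CubeC x r)
    (i : Fin n) : dyadicIndex x r k y i < 2 ^ k := by
  have h1 : (y i - x i + r) / (2 * r) < 1 := by
    rw [div_lt_one (by positivity)]
    linarith [(hy i).2]
  have h0 : 0 ≤ (y i - x i + r) / (2 * r) := div_nonneg (by linarith [(hy i).1]) (by positivity)
  rw [dyadicIndex, Nat.floor_lt (by positivity)]
  push_cast
  exact mul_lt_of_lt_one_right (by positivity) h1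

lemma setOf_dyadicIndex_eq {x : Rn n} {r : ℝ} (hr : 0 < r) {k : ℕ} {m : Fin n → ℕ}
    (hm : ∀ i, m i < 2 ^ k) : {y ∈ CubeC x r | dyadicIndex x r k y = m} =
      {y : Rn n | ∀ i, x i - r + 2 * r * m i / 2 ^ k ≤ y i ∧
        y i < x i - r + 2 * r * m i / 2 ^ k + 2 * r / 2 ^ k} := by
  have key : ∀ (y : Rn n) i, x i - r ≤ y i → (dyadicIndex x r k y i = m i ↔
      x i - r + 2 * r * m i / 2 ^ k ≤ y i ∧
        y i < x i - r + 2 * r * m i / 2 ^ k + 2 * r / 2 ^ k) := by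
    intro y i hi
    have h0 : 0 ≤ 2 ^ k * ((y i - x i + r) / (2 * r)) :=
      mul_nonneg (by positivity) (div_nonneg (by linarith) (by positivity))
    have e1 : 2 ^ k * ((y i - x i + r) / (2 * r)) = (y i - x i + r) / (2 * r / 2 ^ k) := by
      field_simp
    have e2 : 2 * r * m i / 2 ^ k = m i * (2 * r / 2 ^ k) := by ring
    have hs : 0 < 2 * r / 2 ^ k := by positivity
    rw [dyadicIndex, Nat.floor_eq_iff h0, e1, e2, le_div_iff₀ hs, div_lt_iff₀ hs, add_mul, one_mul]
    constructor <;> rintro ⟨h1, h2⟩ <;> constructor <;> linarith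
  ext y
  simp only [mem_ofPred_eq, funext_iff]
  constructor
  · rintro ⟨hy, h⟩ i
    exact (key y i (hy i).1).mp (h i)
  · intro h
    have hlow : ∀ i, x i - r ≤ y i := fun i => by
      have : 0 ≤ 2 * r * m i / 2 ^ k := by positivity
      linarith [(h i).1]
    refine ⟨fun i => ⟨hlow i, ?_⟩, fun i => (key y i (hlow i)).mpr (h i)⟩
    have h1 : (m i : ℝ) + 1 ≤ 2 ^ k := by exact_mod_cast hm i
    have h2 : 2 * r * m i / 2 ^ k + 2 * r / 2 ^ k ≤ 2 * r := by
      rw [← add_div, div_le_iff₀ (by positivity)]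
      nlinarith
    linarith [(h i).2]

lemma dyadicIndex_of_succ {x : Rn n} {r : ℝ} {k : ℕ} {y z : Rn n}
    (h : dyadicIndex x r (k + 1) y = dyadicIndex x r (k + 1) z) :
    dyadicIndex x r k y = dyadicIndex x r k z := by
  have key : ∀ (y : Rn n) i, dyadicIndex x r k y i = dyadicIndex x r (k + 1) y i / 2 := by
    intro y i
    rw [dyadicIndex, dyadicIndex, ← Nat.floor_div_ofNat]
    congr 1
    ring
  ext i
  rw [key, key, h]

/-- The grid of dyadic subcubes of `CubeC x r`. -/
def cubeGrid (x : Rn n) (r : ℝ) (hr : 0 < r) : DyadicGrid (Rn n) (Fin n → ℕ) volume where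
  Q := CubeC x r
  idx := dyadicIndex x r
  V k := ENNReal.ofReal (2 * r / 2 ^ k) ^ n
  Λ := 2 ^ n
  idx_zero y hy z hz := by
    ext i
    have h1 := dyadicIndex_lt hr (k := 0) hy i
    have h2 := dyadicIndex_lt hr (k := 0) hz i
    omega
  idx_succ k y _ z _ h := dyadicIndex_of_succ h
  measurableSet_cell k j := by
    by_cases hj : ∀ i, j i < 2 ^ k
    · rw [setOf_dyadicIndex_eq hr hj]
      exact measurableSet_box _ _
    · convert MeasurableSet.empty
      rw [eq_empty_iff_forall_notMem]
      rintro y ⟨hy, rfl⟩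
      exact hj fun i => dyadicIndex_lt hr hy i
  measure_cell k y hy := by
    rw [setOf_dyadicIndex_eq hr fun i => dyadicIndex_lt hr hy i, volume_box]
    simp
  V_ne_zero k := by
    have : 0 < 2 * r / 2 ^ k := by positivity
    exact pow_ne_zero _ (by simpa using this)
  V_ne_top k := ENNReal.pow_ne_top ENNReal.ofReal_ne_top
  V_le k := by
    rw [← mul_pow, ← ENNReal.ofReal_ofNat 2, ← ENNReal.ofReal_mul (by norm_num)]
    gcongr
    rw [pow_succ]
    apply le_of_eq
    field_simp
  one_le_Λ := one_le_pow₀ (by norm_num)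

lemma isDyadicSubC_cell {x : Rn n} {r : ℝ} {hr : 0 < r} {i : ℕ × (Fin n → ℕ)}
    (h : ((cubeGrid x r hr).cell i).Nonempty) : IsDyadicSubC x r ((cubeGrid x r hr).cell i) := by
  obtain ⟨y, hy, hyi⟩ := h
  have hm : ∀ j, i.2 j < 2 ^ i.1 := fun j => by
    rw [← hyi]
    exact dyadicIndex_lt hr hy j
  exact ⟨i.1, i.2, hm, setOf_dyadicIndex_eq hr hm⟩

lemma convex_cell {x : Rn n} {r : ℝ} (hr : 0 < r) (i : ℕ × (Fin n → ℕ)) :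
    Convex ℝ ((cubeGrid x r hr).cell i) := by
  rcases ((cubeGrid x r hr).cell i).eq_empty_or_nonempty with h | h
  · rw [h]
    exact convex_empty
  · obtain ⟨k, m, _, h⟩ := isDyadicSubC_cell h
    rw [h]
    exact convex_box _ _

lemma edist_le_of_mem_cell {x : Rn n} {r : ℝ} (hr : 0 < r) (i : ℕ × (Fin n → ℕ)) {y z : Rn n}
    (hy : y ∈ (cubeGrid x r hr).cell i) (hz : z ∈ (cubeGrid x r hr).cell i) :
    edist y z ≤ ENNReal.ofReal √n * ENNReal.ofReal (2 * r / 2 ^ i.1) := by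
  have hm : ∀ j, i.2 j < 2 ^ i.1 := fun j => by
    rw [← hy.2]
    exact dyadicIndex_lt hr hy.1 j
  have hcell : (cubeGrid x r hr).cell i = _ := setOf_dyadicIndex_eq hr hm
  rw [hcell] at hy hz
  rw [← ENNReal.ofReal_mul (by positivity), edist_dist]
  refine ENNReal.ofReal_le_ofReal (dist_le_sqrt_mul (by positivity) fun j => ?_)
  rw [abs_le]
  constructor <;> linarith [(hy j).1, (hy j).2, (hz j).1, (hz j).2]

end Cubes

section LocalPoincare

variable {n : ℕ}

/-- The constant in the two-weight Poincaré inequality on a cube. -/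
def localConst (n : ℕ) (p q : ℝ) (K a : ℝ≥0∞) : ℝ≥0∞ :=
  (2 ^ n * ENNReal.ofReal √n * 2 ^ n) ^ q *
    ((2 * a) ^ q * ((2 * ENNReal.ofReal (2 ^ (q / (q - 1)) * q)) ^ (q - 1) *
      (K ^ q * (2 * ENNReal.ofReal (2 ^ p * (p / (p - 1)))) ^ (q / p))))

lemma localConst_ne_top {p q : ℝ} (hp : 1 < p) (hpq : p ≤ q) {K a : ℝ≥0∞} (hK : K ≠ ∞)
    (ha : a ≠ ∞) : localConst n p q K a ≠ ∞ := by
  have hp0 : 0 < p := by linarith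
  have hq0 : 0 ≤ q := by linarith
  have hq1 : 0 ≤ q - 1 := by linarith
  unfold localConst
  refine ENNReal.mul_ne_top (ENNReal.rpow_ne_top_of_nonneg hq0 ?_)
    (ENNReal.mul_ne_top (ENNReal.rpow_ne_top_of_nonneg hq0 (ENNReal.mul_ne_top (by simp) ha))
    (ENNReal.mul_ne_top (ENNReal.rpow_ne_top_of_nonneg hq1
      (ENNReal.mul_ne_top (by simp) ENNReal.ofReal_ne_top))
    (ENNReal.mul_ne_top (ENNReal.rpow_ne_top_of_nonneg hq0 hK)
    (ENNReal.rpow_ne_top_of_nonneg (by positivity)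
      (ENNReal.mul_ne_top (by simp) ENNReal.ofReal_ne_top)))))
  exact ENNReal.mul_ne_top (ENNReal.mul_ne_top (ENNReal.pow_ne_top (by simp))
    ENNReal.ofReal_ne_top) (ENNReal.pow_ne_top (by simp))

lemma exists_stopping_ratio (Λ : ℝ≥0∞) (hΛ : Λ ≠ ∞) (C : ℝ) {δ : ℝ} (hδ : 0 < δ) :
    ∃ a₀ : ℝ≥0∞, a₀ ≠ ∞ ∧ ∀ a, a₀ ≤ a → a ≠ ∞ → ENNReal.ofReal C * (Λ / a) ^ δ ≤ 2⁻¹ := by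
  set B : ℝ≥0∞ := 2 * ENNReal.ofReal C + 1 with hB
  have hB0 : B ≠ 0 := by simp [hB]
  have hBt : B ≠ ∞ := by
    rw [hB]
    exact ENNReal.add_ne_top.mpr ⟨ENNReal.mul_ne_top (by simp) ENNReal.ofReal_ne_top, by simp⟩
  refine ⟨Λ * B ^ (1 / δ) + 1, ENNReal.add_ne_top.mpr ⟨ENNReal.mul_ne_top hΛ
    (ENNReal.rpow_ne_top_of_nonneg (by positivity) hBt), by simp⟩, fun a ha hat => ?_⟩
  have ha0 : a ≠ 0 := fun h => by simp [h] at ha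
  have h1 : Λ / a ≤ (B ^ (1 / δ))⁻¹ := by
    have hb0 : B ^ (1 / δ) ≠ 0 := by simp [hB0, hBt]
    have hbt : B ^ (1 / δ) ≠ ∞ := ENNReal.rpow_ne_top_of_nonneg (by positivity) hBt
    rw [ENNReal.div_le_iff ha0 hat, mul_comm, ← div_eq_mul_inv,
      ENNReal.le_div_iff_mul_le (Or.inl hb0) (Or.inl hbt)]
    exact le_self_add.trans ha
  calc ENNReal.ofReal C * (Λ / a) ^ δ ≤ ENNReal.ofReal C * ((B ^ (1 / δ))⁻¹) ^ δ := by gcongr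
    _ = ENNReal.ofReal C * B⁻¹ := by
        rw [ENNReal.inv_rpow, ← ENNReal.rpow_mul, one_div_mul_cancel hδ.ne', ENNReal.rpow_one]
    _ ≤ 2⁻¹ := by
        rw [← div_eq_mul_inv, ENNReal.div_le_iff hB0 hBt, hB, mul_add, ← mul_assoc,
          ENNReal.inv_mul_cancel (by simp) (by simp), one_mul]
        exact le_self_add

lemma wMass_restrict_withDensity {w : Rn n → ℝ} {Q E : Set (Rn n)} (hE : MeasurableSet E)
    (hEQ : E ⊆ Q) :
    (volume.restrict Q).withDensity (fun x => ENNReal.ofReal (w x)) E = wMass w E := by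
  rw [withDensity_apply _ hE, Measure.restrict_restrict hE, inter_eq_left.mpr hEQ, wMass]

lemma rpow_one_div_of_weight_condition {m p q : ℝ} (hm : m ≠ 0) (hp : 0 < p) {l W S K : ℝ≥0∞}
    (hl0 : l ≠ 0) (hlt : l ≠ ∞)
    (h : (l ^ m) ^ (-(1 - 1 / m) * p) * W ^ (p / q) * S ^ (p - 1) ≤ K) :
    l * (l ^ m)⁻¹ * W ^ (1 / q) * S ^ (1 - 1 / p) ≤ K ^ (1 / p) := by
  rw [one_div p, ENNReal.le_rpow_inv_iff hp]
  refine le_trans (le_of_eq ?_) h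
  have e1 : l * (l ^ m)⁻¹ = l ^ (1 - m) := by
    rw [← ENNReal.rpow_neg, sub_eq_add_neg, ENNReal.rpow_add _ _ hl0 hlt, ENNReal.rpow_one]
  rw [e1, ENNReal.mul_rpow_of_nonneg _ _ hp.le, ENNReal.mul_rpow_of_nonneg _ _ hp.le,
    ← ENNReal.rpow_mul, ← ENNReal.rpow_mul, ← ENNReal.rpow_mul, ← ENNReal.rpow_mul,
    show (1 - m) * p = m * (-(1 - 1 / m) * p) by field_simp; ring,
    show 1 / q * p = p / q by ring, show (1 - p⁻¹) * p = p - 1 by field_simp]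

/-- The two-weight Poincaré inequality on a cube under dyadic conditions on the weights. -/
theorem local_two_weight_poincare (hn : 0 < n) {p q : ℝ} (hp : 1 < p) (hpq : p ≤ q)
    {x : Rn n} {r : ℝ} (hr : 0 < r) {w v : Rn n → ℝ}
    (hw : AEMeasurable w (volume.restrict (CubeC x r)))
    (hv : AEMeasurable v (volume.restrict (CubeC x r)))
    (hvpos : ∀ᵐ y ∂(volume.restrict (CubeC x r)), 0 < v y)
    (hw0 : wMass w (CubeC x r) ≠ 0) (hwt : wMass w (CubeC x r) ≠ ∞)
    {Cw δw Cσ δσ : ℝ} (hδw : 0 < δw) (hδσ : 0 < δσ) {a K : ℝ≥0∞} (ha1 : 1 < a) (hat : a ≠ ∞)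
    (hKt : K ≠ ∞)
    (haw : ENNReal.ofReal Cw * (2 ^ n / a) ^ δw ≤ 2⁻¹)
    (haσ : ENNReal.ofReal Cσ * (2 ^ n / a) ^ δσ ≤ 2⁻¹)
    (hAw : ∀ R : Set (Rn n), IsDyadicSubC x r R → ∀ E : Set (Rn n), MeasurableSet E → E ⊆ R →
      wMass w E ≤ ENNReal.ofReal Cw * (volume E / volume R) ^ δw * wMass w R)
    (hAσ : ∀ R : Set (Rn n), IsDyadicSubC x r R → ∀ E : Set (Rn n), MeasurableSet E → E ⊆ R →
      wMass (fun x => v x ^ (-(1 / (p - 1)))) E ≤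
        ENNReal.ofReal Cσ * (volume E / volume R) ^ δσ * wMass (fun x => v x ^ (-(1 / (p - 1)))) R)
    (hK : ∀ R : Set (Rn n), IsDyadicSubC x r R →
      volume R ^ (-(1 - 1 / (n : ℝ)) * p) * wMass w R ^ (p / q) *
        wMass (fun x => v x ^ (-(1 / (p - 1)))) R ^ (p - 1) ≤ K)
    {L : ℝ≥0} {u : Rn n → ℝ} (hu : LipschitzWith L u) :
    ∫⁻ y in CubeC x r, edist (⨍ z in CubeC x r, u z) (u y) ^ q * ENNReal.ofReal (w y) ≤
      localConst n p q (K ^ (1 / p)) a *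
        (∫⁻ y in CubeC x r, ‖fderiv ℝ u y‖ₑ ^ p * ENNReal.ofReal (v y)) ^ (q / p) := by
  have hp0 : 0 < p := by linarith
  have hq0 : 0 < q := by linarith
  have hn0 : (n : ℝ) ≠ 0 := by exact_mod_cast hn.ne'
  set G := cubeGrid x r hr with hG
  set Q := CubeC x r with hQ
  have hQm : MeasurableSet Q := measurableSet_cubeC x r
  set s : ℝ := 1 / (p - 1) with hs
  have hsp : -s + s * p = 1 := by
    rw [hs]
    field_simp [(by linarith : p - 1 ≠ 0)]
    ring
  set σ : Rn n → ℝ := fun x => v x ^ (-s) with hσ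
  have hσm : AEMeasurable σ (volume.restrict Q) := hv.pow_const _
  set μ := (volume.restrict Q).withDensity (fun x => ENNReal.ofReal (w x)) with hμ
  set τ := (volume.restrict Q).withDensity (fun x => ENNReal.ofReal (σ x)) with hτ
  have hcellQ : ∀ i, G.cell i ⊆ Q := DyadicGrid.cell_subset
  have hcellm : ∀ i, MeasurableSet (G.cell i) := fun i => DyadicGrid.measurableSet_cell' i
  have hQvol0 : volume Q ≠ 0 := by
    rw [hQ, volume_cubeC]
    exact pow_ne_zero _ (by simpa using hr)
  have hQvolt : volume Q ≠ ∞ := by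
    rw [hQ, volume_cubeC]
    exact ENNReal.pow_ne_top ENNReal.ofReal_ne_top
  have hσt : wMass σ Q ≠ ∞ := by
    intro htop
    have h := hK Q (isDyadicSubC_self x r)
    rw [htop, ENNReal.top_rpow_of_pos (by linarith), ENNReal.mul_top] at h
    · exact hKt (top_le_iff.mp h)
    · refine mul_ne_zero ?_ ?_
      · simp [hQvol0, hQvolt]
      · rw [Ne, ENNReal.rpow_eq_zero_iff]
        simp [hw0, hwt]
  set g : Rn n → ℝ≥0∞ := fun y => ‖fderiv ℝ u y‖ₑ with hg
  have hgm : Measurable g := (measurable_fderiv ℝ u).enorm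
  set v' := hv.mk v with hv'
  have hv'm : Measurable v' := hv.measurable_mk
  have hvv' : ∀ᵐ y ∂(volume.restrict Q), 0 < v y ∧ v' y = v y := by
    filter_upwards [hvpos, hv.ae_eq_mk] with y h1 h2
    exact ⟨h1, h2.symm⟩
  set h : Rn n → ℝ≥0∞ := fun y => g y * ENNReal.ofReal (v' y ^ s) with hh
  have hhm : Measurable h := hgm.mul (hv'm.pow_const _).ennreal_ofReal
  have hfh : ∀ i, ∫⁻ y in G.cell i, g y = ∫⁻ y in G.cell i, h y ∂τ := by
    intro i
    rw [hτ, restrict_withDensity (hcellm i), Measure.restrict_restrict (hcellm i),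
      inter_eq_left.mpr (hcellQ i), lintegral_withDensity_eq_lintegral_mul₀
        (hσm.mono_measure (Measure.restrict_mono_set _ (hcellQ i))).ennreal_ofReal
        hhm.aemeasurable]
    refine lintegral_congr_ae ?_
    filter_upwards [ae_mono (Measure.restrict_mono_set volume (hcellQ i)) hvv'] with y hy
    simp only [Pi.mul_apply, hh, hσ, hy.2]
    rw [mul_left_comm, ← ENNReal.ofReal_mul (by have := hy.1; positivity),
      ← Real.rpow_add hy.1]
    simp
  have hhp : ∫⁻ y, h y ^ p ∂τ = ∫⁻ y in Q, g y ^ p * ENNReal.ofReal (v y) := by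
    rw [hτ, lintegral_withDensity_eq_lintegral_mul₀ hσm.ennreal_ofReal
      (hhm.pow_const _).aemeasurable]
    refine lintegral_congr_ae ?_
    filter_upwards [hvv'] with y hy
    have hy1 := hy.1
    simp only [Pi.mul_apply, hh, hσ, hy.2]
    rw [ENNReal.mul_rpow_of_nonneg _ _ hp0.le, ENNReal.ofReal_rpow_of_nonneg (by positivity) hp0.le,
      ← Real.rpow_mul hy1.le, mul_left_comm, ← ENNReal.ofReal_mul (by positivity),
      ← Real.rpow_add hy1, hsp, Real.rpow_one]
  have hgQ : ∫⁻ y in G.Q, g y ≠ ∞ := by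
    refine ne_top_of_le_ne_top (ENNReal.mul_ne_top ENNReal.coe_ne_top hQvolt)
      (b := (L : ℝ≥0∞) * volume Q) ?_
    rw [← setLIntegral_const]
    refine lintegral_mono fun y => ?_
    exact enorm_le_coe.mpr (norm_fderiv_le_of_lipschitz ℝ hu)
  have hA : ∀ (ω : Rn n → ℝ) (C δ : ℝ), 0 < δ → ENNReal.ofReal C * (2 ^ n / a) ^ δ ≤ 2⁻¹ →
      (∀ R : Set (Rn n), IsDyadicSubC x r R → ∀ E : Set (Rn n), MeasurableSet E → E ⊆ R →
        wMass ω E ≤ ENNReal.ofReal C * (volume E / volume R) ^ δ * wMass ω R) →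
      ∀ i, (G.cell i).Nonempty → ∀ E, MeasurableSet E → E ⊆ G.cell i →
        volume E ≤ G.Λ / a * volume (G.cell i) →
        (volume.restrict Q).withDensity (fun x => ENNReal.ofReal (ω x)) E ≤
        2⁻¹ * (volume.restrict Q).withDensity (fun x => ENNReal.ofReal (ω x)) (G.cell i) := by
    intro ω C δ hδ hC hω i hi E hE hEi hvol
    rw [wMass_restrict_withDensity hE (hEi.trans (hcellQ i)),
      wMass_restrict_withDensity (hcellm i) (hcellQ i)]
    refine (hω _ (isDyadicSubC_cell hi) E hE hEi).trans ?_
    gcongr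
    refine le_trans ?_ hC
    gcongr ENNReal.ofReal C * ?_ ^ δ
    exact ENNReal.div_le_of_le_mul hvol
  set l : ℕ → ℝ≥0∞ := fun k => ENNReal.ofReal (2 * r / 2 ^ k) with hl
  have hladd : ∀ i m, l (i + m) = l i * 2⁻¹ ^ m := by
    intro i m
    have h2 : (2⁻¹ : ℝ≥0∞) = ENNReal.ofReal 2⁻¹ := by
      rw [ENNReal.ofReal_inv_of_pos (by norm_num), ENNReal.ofReal_ofNat]
    simp only [hl]
    rw [h2, ← ENNReal.ofReal_pow (by norm_num), ← ENNReal.ofReal_mul (by positivity)]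
    congr 1
    rw [pow_add, inv_pow]
    field_simp
  have hlim : Filter.Tendsto l Filter.atTop (nhds 0) := by
    have h1 : l = fun k => l 0 * 2⁻¹ ^ k := by
      ext k
      rw [← hladd, zero_add]
    rw [h1, ← mul_zero (l 0)]
    exact ENNReal.Tendsto.const_mul (ENNReal.tendsto_pow_atTop_nhds_zero_of_lt_one (by simp))
      (Or.inr ENNReal.ofReal_ne_top)
  have hKcell : ∀ i, (G.cell i).Nonempty →
      l i.1 * (G.V i.1)⁻¹ * μ (G.cell i) ^ (1 / q) * τ (G.cell i) ^ (1 - 1 / p) ≤ K ^ (1 / p) := by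
    intro i hi
    have hpos : 0 < 2 * r / 2 ^ i.1 := by positivity
    have hl0 : l i.1 ≠ 0 := by simpa [hl] using hpos
    have hlt : l i.1 ≠ ∞ := ENNReal.ofReal_ne_top
    obtain ⟨y, hy⟩ := id hi
    have hvol : volume (G.cell i) = l i.1 ^ (n : ℝ) := by
      rw [DyadicGrid.measure_cell_of_mem hy, ENNReal.rpow_natCast]
      rfl
    have hV : G.V i.1 = l i.1 ^ (n : ℝ) := by
      rw [ENNReal.rpow_natCast]
      rfl
    have h1 : volume (G.cell i) ^ (-(1 - 1 / (n : ℝ)) * p) * wMass w (G.cell i) ^ (p / q) *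
        wMass σ (G.cell i) ^ (p - 1) ≤ K := hK _ (isDyadicSubC_cell hi)
    rw [hvol] at h1
    rw [hμ, hτ, wMass_restrict_withDensity (hcellm i) (hcellQ i),
      wMass_restrict_withDensity (hcellm i) (hcellQ i), hV]
    exact rpow_one_div_of_weight_condition hn0 hp0 hl0 hlt h1
  have hmain := DyadicGrid.lintegral_tsum_avg_rpow_le (G := G) (μ := μ) (τ := τ)
    (by rw [hμ]; exact (wMass_restrict_withDensity hQm subset_rfl).trans_ne hwt)
    (by rw [hτ]; exact (wMass_restrict_withDensity hQm subset_rfl).trans_ne hσt)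
    hp hpq hhm hgQ hfh hladd (fun _ => ENNReal.ofReal_ne_top) ha1 hat
    (hA w Cw δw hδw haw hAw) (hA σ Cσ δσ hδσ haσ hAσ) hKcell
  have hpoint := fun y (hy : y ∈ Q) => G.edist_setAverage_le_tsum (convex_cell hr)
    (A := ENNReal.ofReal √n) ENNReal.ofReal_ne_top (fun k => ENNReal.ofReal_ne_top) hlim
    (fun i y hy z hz => edist_le_of_mem_cell hr i hy hz) hu (y := y) hy
  set S : Rn n → ℝ≥0∞ := fun y => ∑' k, l k * G.avg g (k, G.idx k y) with hS
  set M : ℝ≥0∞ := 2 ^ n * ENNReal.ofReal √n * 2 ^ n with hM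
  have hMt : M ≠ ∞ := ENNReal.mul_ne_top (ENNReal.mul_ne_top (ENNReal.pow_ne_top (by simp))
    ENNReal.ofReal_ne_top) (ENNReal.pow_ne_top (by simp))
  have hFm : Measurable fun y => edist (⨍ z in Q, u z) (u y) :=
    measurable_const.edist hu.continuous.measurable
  calc ∫⁻ y in Q, edist (⨍ z in Q, u z) (u y) ^ q * ENNReal.ofReal (w y)
      = ∫⁻ y in Q, edist (⨍ z in Q, u z) (u y) ^ q ∂μ := by
        rw [hμ, restrict_withDensity hQm, Measure.restrict_restrict hQm, inter_self,
          lintegral_withDensity_eq_lintegral_mul₀ hw.ennreal_ofReal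
            (hFm.pow_const q).aemeasurable]
        simp only [Pi.mul_apply, mul_comm]
    _ ≤ ∫⁻ y in Q, (M * S y) ^ q ∂μ := by
        refine setLIntegral_mono' hQm fun y hy => ?_
        gcongr
        have := hpoint y hy
        rwa [finrank_euclideanSpace_fin] at this
    _ = M ^ q * ∫⁻ y in Q, S y ^ q ∂μ := by
        simp_rw [ENNReal.mul_rpow_of_nonneg _ (S _) hq0.le]
        rw [lintegral_const_mul' _ _ (ENNReal.rpow_ne_top_of_nonneg hq0.le hMt)]
    _ ≤ _ := by
        refine (mul_le_mul_right hmain _).trans (le_of_eq ?_)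
        rw [hhp, localConst, ENNReal.mul_rpow_of_nonneg _ (∫⁻ y in Q, _) (by positivity)]
        ring

end LocalPoincare

section WhitneyGeometry

variable {n : ℕ} {Ω : Set (Rn n)} {Cdim : ℝ}

lemma mem_cubeC_self (x : Rn n) {r : ℝ} (hr : 0 < r) : x ∈ CubeC x r :=
  fun _ => ⟨by linarith, by linarith⟩

lemma cubeC_subset_cubeC {x y : Rn n} {r s : ℝ} (h : ∀ i, |x i - y i| + r ≤ s) :
    CubeC x r ⊆ CubeC y s := fun z hz i => by
  have h1 := hz i
  have h2 := h i
  have h3 := abs_le.1 (le_refl |x i - y i|)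
  constructor <;> linarith

lemma abs_sub_le_of_mem_cubeC {x y : Rn n} {r : ℝ} (hy : y ∈ CubeC x r) (i : Fin n) :
    |y i - x i| ≤ r := by
  have := hy i
  rw [abs_le]
  constructor <;> linarith

lemma dist_le_of_mem_cubeC {x y z : Rn n} {r : ℝ} (hr : 0 ≤ r) (hy : y ∈ CubeC x r)
    (hz : z ∈ CubeC x r) : dist y z ≤ √n * (2 * r) :=
  dist_le_sqrt_mul (by linarith) fun i => by
    have h1 := hy i
    have h2 := hz i
    rw [abs_le]
    constructor <;> linarith

lemma setDist_le_dist {A B : Set (Rn n)} {x y : Rn n} (hx : x ∈ A) (hy : y ∈ B) :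
    setDist A B ≤ dist x y :=
  csInf_le ⟨0, by rintro _ ⟨a, -, b, -, rfl⟩; exact dist_nonneg⟩ ⟨x, hx, y, hy, rfl⟩

lemma le_setDist {A B : Set (Rn n)} (hA : A.Nonempty) (hB : B.Nonempty) {d : ℝ}
    (h : ∀ x ∈ A, ∀ y ∈ B, d ≤ dist x y) : d ≤ setDist A B := by
  obtain ⟨a, ha⟩ := hA
  obtain ⟨b, hb⟩ := hB
  refine le_csInf ⟨_, a, ha, b, hb, rfl⟩ ?_
  rintro _ ⟨x, hx, y, hy, rfl⟩
  exact h x hx y hy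

/-- A cube centred near a point `x` of `Q(a, r) ∩ Q(b, R)` and contained in both `Q(b, R)` and the
dilate of `Q(a, r)` by the factor `9/8`. -/
lemma exists_cubeC_subset_inter {a b x : Rn n} {r R ρ : ℝ} (hρ : 0 < ρ) (hr : 16 * ρ ≤ r)
    (hR : 2 * ρ ≤ R) (hxa : x ∈ CubeC a r) (hxb : x ∈ CubeC b R) :
    ∃ g : Rn n, (∀ i, |g i - x i| ≤ ρ) ∧ CubeC g ρ ⊆ CubeC a (9 / 8 * r) ∩ CubeC b R := by
  refine ⟨WithLp.toLp 2 fun i => if x i < b i then x i + ρ else x i - ρ, fun i => ?_,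
    fun y hy => ⟨fun i => ?_, fun i => ?_⟩⟩
  · simp only
    split_ifs <;> simp [abs_of_pos hρ]
  all_goals
    have h1 := hy i
    have h2 := hxa i
    have h3 := hxb i
    simp only at h1
    split_ifs at h1 with h <;> constructor <;> linarith

namespace WhitneyDecomp

variable (W : WhitneyDecomp n Ω Cdim)

lemma subset_domain {Q : Set (Rn n)} (hQ : Q ∈ W.cubes) : Q ⊆ Ω :=
  fun _ hx => W.union_eq ▸ mem_sUnion_of_mem hx hQ

lemma center_mem {Q : Set (Rn n)} (hQ : Q ∈ W.cubes) : W.center Q ∈ Q := by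
  have h := mem_cubeC_self (W.center Q) (W.radius_pos Q hQ)
  rwa [← W.eq_cube Q hQ] at h

lemma measurableSet_cube {Q : Set (Rn n)} (hQ : Q ∈ W.cubes) : MeasurableSet Q := by
  rw [W.eq_cube Q hQ]
  exact measurableSet_cubeC _ _

lemma subset_Qstar {Q : Set (Rn n)} (hQ : Q ∈ W.cubes) : Q ⊆ Qstar W Q := by
  have hr := W.radius_pos Q hQ
  conv_lhs => rw [W.eq_cube Q hQ]
  exact cubeC_subset_cubeC fun i => by simp; linarith

lemma one_le_const {Q : Set (Rn n)} (hQ : Q ∈ W.cubes) : 1 ≤ Cdim := by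
  refine le_trans ?_ (W.overlap_le (W.center Q))
  have : 0 < ({P ∈ W.cubes | W.center Q ∈ CubeC (W.center P) (9 / 8 * W.radius P)}).ncard := by
    rw [Set.ncard_pos (W.overlap_finite _)]
    exact ⟨Q, hQ, W.subset_Qstar hQ (W.center_mem hQ)⟩
  exact_mod_cast this

lemma frontier_nonempty (hn : 0 < n) (hΩb : Bornology.IsBounded Ω) (hΩ : Ω.Nonempty) :
    (frontier Ω).Nonempty := by
  have : Nonempty (Fin n) := ⟨⟨0, hn⟩⟩
  rw [nonempty_frontier_iff]
  refine ⟨hΩ, fun h => ?_⟩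
  rw [h] at hΩb
  exact NormedSpace.unbounded_univ ℝ (Rn n) hΩb

/-- The dilated Whitney cubes have a positive distance from the boundary. -/
lemma exists_dist_frontier {Q : Set (Rn n)} (hQ : Q ∈ W.cubes) :
    ∃ d > 0, ∀ y ∈ Qstar W Q, ∀ z ∈ frontier Ω, d ≤ dist y z := by
  have hC := W.one_le_const hQ
  have hr := W.radius_pos Q hQ
  have h := W.dist_lower Q hQ
  refine ⟨setDist (Qstar W Q) (frontier Ω), ?_, fun y hy z hz => setDist_le_dist hy hz⟩
  have : 0 < Cdim * setDist (Qstar W Q) (frontier Ω) := lt_of_lt_of_le (by linarith) h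
  exact (pos_iff_pos_of_mul_pos this).1 (by linarith)

lemma closure_Qstar_subset (hΩo : IsOpen Ω) {Q : Set (Rn n)} (hQ : Q ∈ W.cubes) :
    closure (Qstar W Q) ⊆ Ω := by
  obtain ⟨d, hd, h⟩ := W.exists_dist_frontier hQ
  have hdisj : Disjoint (closure (Qstar W Q)) (frontier Ω) := by
    rw [Set.disjoint_left]
    intro y hy hyf
    obtain ⟨z, hz, hyz⟩ := Metric.mem_closure_iff.1 hy d hd
    have := h z hz y hyf
    rw [dist_comm] at this
    linarith
  have hconn : IsPreconnected (closure (Qstar W Q)) :=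
    (convex_cubeC _ _).closure.isPreconnected
  refine hconn.subset_left_of_subset_union hΩo isClosed_closure.isOpen_compl
    (disjoint_compl_right.mono_left subset_closure) (fun y hy => ?_)
    ⟨_, subset_closure (W.subset_Qstar hQ (W.center_mem hQ)),
      W.subset_domain hQ (W.center_mem hQ)⟩
  by_contra hne
  rw [mem_union, not_or, mem_compl_iff, not_not] at hne
  exact Set.disjoint_left.1 hdisj hy (hΩo.frontier_eq ▸ ⟨hne.2, hne.1⟩)

lemma Qstar_subset (hΩo : IsOpen Ω) {Q : Set (Rn n)} (hQ : Q ∈ W.cubes) :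
    Qstar W Q ⊆ Ω := subset_closure.trans (W.closure_Qstar_subset hΩo hQ)

lemma isCompact_closure_Qstar (hΩb : Bornology.IsBounded Ω) (hΩo : IsOpen Ω) {Q : Set (Rn n)}
    (hQ : Q ∈ W.cubes) : IsCompact (closure (Qstar W Q)) :=
  Metric.isCompact_of_isClosed_isBounded isClosed_closure
    (hΩb.subset (W.closure_Qstar_subset hΩo hQ))

/-- Touching dilated Whitney cubes have comparable sizes. -/
lemma radius_le_of_inter_nonempty (hn : 0 < n) (hΩb : Bornology.IsBounded Ω) {P T : Set (Rn n)}
    (hP : P ∈ W.cubes) (hT : T ∈ W.cubes) (h : (Qstar W P ∩ Qstar W T).Nonempty) :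
    W.radius T ≤ Cdim * (√n + Cdim) * W.radius P := by
  have hC := W.one_le_const hP
  have hrP := W.radius_pos P hP
  obtain ⟨y, hyP, hyT⟩ := h
  have hf : (frontier Ω).Nonempty :=
    frontier_nonempty hn hΩb ⟨_, W.subset_domain hP (W.center_mem hP)⟩
  have h1 : setDist (Qstar W T) (frontier Ω) - √n * (2 * (9 / 8 * W.radius P)) ≤
      setDist (Qstar W P) (frontier Ω) := by
    refine le_setDist ⟨y, hyP⟩ hf fun x hx z hz => ?_
    have h2 := setDist_le_dist hyT hz
    have h3 := dist_triangle y x z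
    have h4 := dist_le_of_mem_cubeC (by linarith) hyP hx
    linarith
  have h5 := W.dist_upper P hP
  have h6 := W.dist_lower T hT
  rw [Qstar, Qstar] at h1
  have h7 : Cdim * setDist (CubeC (W.center T) (9 / 8 * W.radius T)) (frontier Ω) ≤
      Cdim * (√n * (2 * (9 / 8 * W.radius P)) + Cdim * (9 / 4 * W.radius P)) :=
    mul_le_mul_of_nonneg_left (by linarith) (by linarith)
  nlinarith

/-- The number of Whitney cubes touching a given one is bounded. -/
lemma tsum_neighbors_le (hn : 0 < n) (hΩb : Bornology.IsBounded Ω) {M : ℝ}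
    (hM : Cdim * (√n + Cdim) ≤ M) {T : Set (Rn n)} (hT : T ∈ W.cubes) :
    ∑' R : W.cubes, {R : W.cubes | (Qstar W R ∩ Qstar W T).Nonempty}.indicator
      (fun _ => (1 : ℝ≥0∞)) R ≤ ENNReal.ofReal ((9 / 8 + 9 / 4 * M) * M) ^ n := by
  have hC := W.one_le_const hT
  have hr := W.radius_pos T hT
  have hM0 : 0 < M := lt_of_lt_of_le (by positivity) hM
  have : Countable W.cubes := W.countable
  set S := {R : W.cubes | (Qstar W R ∩ Qstar W T).Nonempty} with hS
  have hlow : ∀ R ∈ S, ENNReal.ofReal (2 * (W.radius T / M)) ^ n ≤ volume (R : Set (Rn n)) := by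
    intro R hR
    rw [W.eq_cube R R.2, volume_cubeC]
    have h1 := W.radius_le_of_inter_nonempty hn hΩb R.2 hT hR
    have h2 := W.radius_pos R R.2
    gcongr
    rw [div_le_iff₀ hM0]
    nlinarith
  have hup : ∀ R ∈ S, (R : Set (Rn n)) ⊆ CubeC (W.center T) ((9 / 8 + 9 / 4 * M) * W.radius T) := by
    intro R hR
    obtain ⟨y, hyR, hyT⟩ := id hR
    have h1 := W.radius_le_of_inter_nonempty hn hΩb hT R.2 (by rwa [inter_comm])
    refine (W.subset_Qstar R.2).trans (cubeC_subset_cubeC fun i => ?_)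
    have h2 := abs_sub_le_of_mem_cubeC hyR i
    have h3 := abs_sub_le_of_mem_cubeC hyT i
    have h4 := abs_sub_le (W.center R i) (y i) (W.center T i)
    rw [abs_sub_comm (W.center R i) (y i)] at h4
    nlinarith
  have hV0 : ENNReal.ofReal (2 * (W.radius T / M)) ^ n ≠ 0 :=
    pow_ne_zero _ (by simp; positivity)
  have hVt : ENNReal.ofReal (2 * (W.radius T / M)) ^ n ≠ ∞ :=
    ENNReal.pow_ne_top ENNReal.ofReal_ne_top
  rw [← ENNReal.mul_le_mul_iff_right hV0 hVt, ← ENNReal.tsum_mul_left]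
  calc ∑' R : W.cubes, ENNReal.ofReal (2 * (W.radius T / M)) ^ n *
        S.indicator (fun _ => (1 : ℝ≥0∞)) R
      ≤ ∑' R : W.cubes, volume ((R : Set (Rn n)) ∩
          CubeC (W.center T) ((9 / 8 + 9 / 4 * M) * W.radius T)) := by
        refine ENNReal.tsum_le_tsum fun R => ?_
        by_cases hR : R ∈ S
        · rw [indicator_of_mem hR, mul_one, inter_eq_left.2 (hup R hR)]
          exact hlow R hR
        · simp [indicator_of_notMem hR]
    _ = volume (⋃ R : W.cubes, (R : Set (Rn n)) ∩
          CubeC (W.center T) ((9 / 8 + 9 / 4 * M) * W.radius T)) := by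
        rw [measure_iUnion]
        · intro P R hPR
          exact (W.pairwise_disjoint P.2 R.2 (Subtype.coe_ne_coe.2 hPR)).mono
            inter_subset_left inter_subset_left
        · exact fun R => (W.measurableSet_cube R.2).inter (measurableSet_cubeC _ _)
    _ ≤ volume (CubeC (W.center T) ((9 / 8 + 9 / 4 * M) * W.radius T)) :=
        measure_mono (iUnion_subset fun R => inter_subset_right)
    _ = ENNReal.ofReal (2 * (W.radius T / M)) ^ n *
          ENNReal.ofReal ((9 / 8 + 9 / 4 * M) * M) ^ n := by
        rw [volume_cubeC, ← mul_pow, ← ENNReal.ofReal_mul (by positivity)]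
        congr 2
        field_simp

/-- The overlap bound for the dilated Whitney cubes, in integrated form. -/
lemma tsum_lintegral_Qstar_le (hΩo : IsOpen Ω) (f : Rn n → ℝ≥0∞)
    (hf : AEMeasurable f (volume.restrict Ω)) :
    ∑' T : W.cubes, ∫⁻ x in Qstar W T, f x ≤ ENNReal.ofReal Cdim * ∫⁻ x in Ω, f x := by
  have : Countable W.cubes := W.countable
  have hm : ∀ T : W.cubes, MeasurableSet (Qstar W T) := fun T => measurableSet_cubeC _ _
  have h1 : ∀ T : W.cubes, ∫⁻ x in Qstar W T, f x =
      ∫⁻ x in Ω, (Qstar W T).indicator (fun _ => 1) x * f x := by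
    intro T
    rw [← inter_eq_left.2 (W.Qstar_subset hΩo T.2), ← Measure.restrict_restrict (hm T),
      ← lintegral_indicator (hm T)]
    refine lintegral_congr fun x => ?_
    by_cases hx : x ∈ Qstar W T
    · simp [hx, inter_eq_left.2 (W.Qstar_subset hΩo T.2)]
    · simp [hx, inter_eq_left.2 (W.Qstar_subset hΩo T.2)]
  simp_rw [h1]
  have hmf : ∀ T : W.cubes, AEMeasurable
      (fun x => (Qstar W T).indicator (fun _ => (1 : ℝ≥0∞)) x * f x) (volume.restrict Ω) :=
    fun T => (measurable_const.indicator (hm T)).aemeasurable.mul hf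
  rw [← lintegral_tsum hmf, ← lintegral_const_mul' _ _ ENNReal.ofReal_ne_top]
  refine lintegral_mono fun x => ?_
  simp only
  rw [ENNReal.tsum_mul_right]
  gcongr
  have hfin := W.overlap_finite x
  set F := {Q ∈ W.cubes | x ∈ CubeC (W.center Q) (9 / 8 * W.radius Q)} with hF
  calc ∑' T : W.cubes, (Qstar W T).indicator (fun _ => (1 : ℝ≥0∞)) x
      = ∑' T : W.cubes, F.indicator (fun _ => (1 : ℝ≥0∞)) (T : Set (Rn n)) := by
        refine tsum_congr fun T => ?_
        by_cases hx : x ∈ Qstar W T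
        · have : (T : Set (Rn n)) ∈ F := ⟨T.2, hx⟩
          simp [hx, this]
        · have : (T : Set (Rn n)) ∉ F := fun h => hx h.2
          simp [hx, this]
    _ ≤ ∑' T : Set (Rn n), F.indicator (fun _ => (1 : ℝ≥0∞)) T :=
        ENNReal.tsum_comp_le_tsum_of_injective Subtype.val_injective _
    _ = (F.ncard : ℝ≥0∞) := by
        rw [← tsum_subtype, ENNReal.tsum_set_one, ← hfin.cast_ncard_eq]
        simp
    _ ≤ ENNReal.ofReal Cdim := by
        rw [← ENNReal.ofReal_natCast]
        exact ENNReal.ofReal_le_ofReal (W.overlap_le x)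

end WhitneyDecomp

end WhitneyGeometry

section Chaining

open Topology

variable {n : ℕ} {Ω : Set (Rn n)} {Cdim : ℝ} {w v u : Rn n → ℝ}

lemma exists_lipschitzWith_eventuallyEq
    (hu : ∀ Kc : Set (Rn n), Kc ⊆ Ω → IsCompact Kc → ∃ L : ℝ≥0, LipschitzOnWith L u Kc)
    (hΩo : IsOpen Ω) {A : Set (Rn n)} (hA : IsCompact A) (hAΩ : A ⊆ Ω) :
    ∃ (L : ℝ≥0) (g : Rn n → ℝ), LipschitzWith L g ∧ ∀ y ∈ A, u =ᶠ[𝓝 y] g := by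
  obtain ⟨δ, hδ, hsub⟩ := hA.exists_cthickening_subset_open hΩo hAΩ
  obtain ⟨L, hL⟩ := hu _ hsub hA.cthickening
  obtain ⟨g, hg, hug⟩ := hL.extend_real
  refine ⟨L, g, hg, fun y hy => ?_⟩
  filter_upwards [Metric.isOpen_thickening.mem_nhds (Metric.self_subset_thickening hδ A hy)]
    with z hz
  exact hug (Metric.thickening_subset_cthickening _ _ hz)

lemma wMass_ne_zero {E : Set (Rn n)} (hE : MeasurableSet E) (hEΩ : E ⊆ Ω) (hE0 : volume E ≠ 0)
    (hw : AEMeasurable w (volume.restrict E))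
    (hwpos : ∀ᵐ x ∂(volume : Measure (Rn n)), x ∈ Ω → 0 < w x) : wMass w E ≠ 0 := by
  intro h
  rw [wMass, lintegral_eq_zero_iff' hw.ennreal_ofReal] at h
  refine hE0 ?_
  have h2 : ∀ᵐ x ∂(volume.restrict E), False := by
    filter_upwards [h, ae_restrict_of_ae hwpos, ae_restrict_mem hE] with x h1 h2 h3
    have := h2 (hEΩ h3)
    simp at h1
    linarith
  simpa using h2

lemma wMass_ne_top {A E : Set (Rn n)} (hw : LocallyIntegrableOn w Ω volume) (hA : IsCompact A)
    (hAΩ : A ⊆ Ω) (hEA : E ⊆ A) : wMass w E ≠ ∞ := by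
  have h := (hw.integrableOn_compact_subset hAΩ hA).mono_set hEA
  exact (Integrable.lintegral_lt_top h).ne

lemma DoublingIn.pow {D : ℝ} (h : DoublingIn Ω w D) {x : Rn n} (hx : x ∈ Ω) {r : ℝ} (hr : 0 < r)
    (k : ℕ) : wMass w (Ω ∩ CubeC x (2 ^ k * r)) ≤
      ENNReal.ofReal D ^ k * wMass w (Ω ∩ CubeC x r) := by
  induction k with
  | zero => simp
  | succ k ih =>
    rw [pow_succ' (2 : ℝ), mul_assoc, pow_succ' (ENNReal.ofReal D), mul_assoc]
    exact (h x hx _ (by positivity)).trans (mul_le_mul_right ih _)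

lemma wMass_mono {E F : Set (Rn n)} (h : E ⊆ F) : wMass w E ≤ wMass w F :=
  lintegral_mono_set h

lemma ENNReal.add_rpow_le_two_rpow (a b : ℝ≥0∞) {q : ℝ} (hq : 0 < q) :
    (a + b) ^ q ≤ 2 ^ q * (a ^ q + b ^ q) := by
  calc (a + b) ^ q ≤ (2 * max a b) ^ q := by
        gcongr
        rw [two_mul]
        exact add_le_add (le_max_left _ _) (le_max_right _ _)
    _ = 2 ^ q * max a b ^ q := ENNReal.mul_rpow_of_nonneg _ _ hq.le
    _ ≤ 2 ^ q * (a ^ q + b ^ q) := by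
        gcongr
        rcases le_total a b with h | h
        · rw [max_eq_right h]; exact le_add_self
        · rw [max_eq_left h]; exact le_self_add

namespace WhitneyDecomp

variable (W : WhitneyDecomp n Ω Cdim)

/-- The averages over two touching dilated Whitney cubes `P*` and `T*` differ by at most the
oscillations over `P*` and `T*`. -/
lemma edist_average_rpow_mul_le (hΩo : IsOpen Ω) {D N M q : ℝ}
    (hq : 0 < q) (hw : AEMeasurable w (volume.restrict Ω)) (hD : DoublingIn Ω w D) {k : ℕ}
    (hM : 1 ≤ M) (hk : (N + 2) * (16 * M) + 1 ≤ 2 ^ k) {P T Q : Set (Rn n)}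
    (hP : P ∈ W.cubes) (hT : T ∈ W.cubes) (hQ : Q ∈ W.cubes) {x : Rn n} (hxT : x ∈ T)
    (hxP : x ∈ Qstar W P) (hxQ : x ∈ Qstar W Q) (hPQ : W.radius Q ≤ M * W.radius P)
    (hTQ : W.radius Q ≤ M * W.radius T)
    (hum : AEMeasurable u (volume.restrict (Qstar W P))) (a b : ℝ) :
    edist a b ^ q * wMass w (Ω ∩ CubeC (W.center Q) (N * W.radius Q)) ≤
      ENNReal.ofReal D ^ k * (2 ^ q *
        ((∫⁻ y in Qstar W P, edist a (u y) ^ q * ENNReal.ofReal (w y)) +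
          ∫⁻ y in Qstar W T, edist b (u y) ^ q * ENNReal.ofReal (w y))) := by
  have hrQ := W.radius_pos Q hQ
  have hrP := W.radius_pos P hP
  have hrT := W.radius_pos T hT
  set ρ := W.radius Q / (16 * M) with hρdef
  have hρ : 0 < ρ := by positivity
  have hρQ : W.radius Q = 16 * M * ρ := by rw [hρdef]; field_simp
  rw [W.eq_cube T hT] at hxT
  obtain ⟨g, hgx, hg⟩ := exists_cubeC_subset_inter hρ (by nlinarith) (by nlinarith) hxT hxP
  have hgP : CubeC g ρ ⊆ Qstar W P := hg.trans inter_subset_right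
  have hgT : CubeC g ρ ⊆ Qstar W T := hg.trans inter_subset_left
  have hgΩ : CubeC g ρ ⊆ Ω := hgP.trans (W.Qstar_subset hΩo hP)
  have hsub : CubeC (W.center Q) (N * W.radius Q) ⊆ CubeC g (2 ^ k * ρ) := by
    refine cubeC_subset_cubeC fun i => ?_
    have h1 := abs_sub_le_of_mem_cubeC hxQ i
    have h2 := hgx i
    have h3 := abs_sub_le (W.center Q i) (x i) (g i)
    rw [abs_sub_comm (W.center Q i) (x i), abs_sub_comm (x i) (g i)] at h3
    have h4 := mul_le_mul_of_nonneg_right hk hρ.le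
    have h5 : ((N + 2) * (16 * M) + 1) * ρ = (N + 2) * W.radius Q + ρ := by rw [hρQ]; ring
    linarith
  have hmass : wMass w (Ω ∩ CubeC (W.center Q) (N * W.radius Q)) ≤
      ENNReal.ofReal D ^ k * wMass w (CubeC g ρ) := by
    calc wMass w (Ω ∩ CubeC (W.center Q) (N * W.radius Q))
        ≤ wMass w (Ω ∩ CubeC g (2 ^ k * ρ)) := wMass_mono (inter_subset_inter_right _ hsub)
      _ ≤ ENNReal.ofReal D ^ k * wMass w (Ω ∩ CubeC g ρ) :=
        hD.pow (hgΩ (mem_cubeC_self g hρ)) hρ k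
      _ = ENNReal.ofReal D ^ k * wMass w (CubeC g ρ) := by rw [inter_eq_right.2 hgΩ]
  refine (mul_le_mul_right hmass _).trans ?_
  rw [mul_left_comm]
  refine mul_le_mul_right ?_ _
  have hm1 : AEMeasurable (fun y => edist a (u y) ^ q * ENNReal.ofReal (w y))
      (volume.restrict (CubeC g ρ)) :=
    ((aemeasurable_const.edist (hum.mono_measure (Measure.restrict_mono hgP le_rfl))).pow_const
      q).mul (hw.mono_measure (Measure.restrict_mono hgΩ le_rfl)).ennreal_ofReal
  calc edist a b ^ q * wMass w (CubeC g ρ)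
      = ∫⁻ y in CubeC g ρ, edist a b ^ q * ENNReal.ofReal (w y) := by
        rw [wMass, lintegral_const_mul' _ _
          (ENNReal.rpow_ne_top_of_nonneg hq.le (edist_ne_top _ _))]
    _ ≤ ∫⁻ y in CubeC g ρ, 2 ^ q * (edist a (u y) ^ q * ENNReal.ofReal (w y) +
          edist b (u y) ^ q * ENNReal.ofReal (w y)) := by
        refine lintegral_mono fun y => ?_
        simp only
        rw [← add_mul, ← mul_assoc]
        gcongr
        refine le_trans ?_ (ENNReal.add_rpow_le_two_rpow _ _ hq)
        gcongr
        exact edist_triangle_right a b (u y)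
    _ = 2 ^ q * ((∫⁻ y in CubeC g ρ, edist a (u y) ^ q * ENNReal.ofReal (w y)) +
          ∫⁻ y in CubeC g ρ, edist b (u y) ^ q * ENNReal.ofReal (w y)) := by
        rw [lintegral_const_mul' _ _ (ENNReal.rpow_ne_top_of_nonneg hq.le (by simp)),
          lintegral_add_left' hm1]
    _ ≤ _ := mul_le_mul_right
        (add_le_add (lintegral_mono_set hgP) (lintegral_mono_set hgT)) _

/-- The dilates `Ω ∩ NR` of the Whitney cubes form a Carleson family for a doubling weight. -/
lemma isCarlesonFamily_dilates {D N : ℝ} (hN : 1 ≤ N) (hΩm : MeasurableSet Ω)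
    (hD : DoublingIn Ω w D) {k : ℕ} (hk : N ≤ 2 ^ k) :
    IsCarlesonFamily ((volume.restrict Ω).withDensity fun x => ENNReal.ofReal (w x))
      (fun R : W.cubes => Ω ∩ CubeC (W.center R) (N * W.radius R))
      (ENNReal.ofReal D ^ k * ENNReal.ofReal D ^ 3) := by
  have hmeas : ∀ R : W.cubes, ∀ s : ℝ, ((volume.restrict Ω).withDensity
      fun x => ENNReal.ofReal (w x)) (Ω ∩ CubeC (W.center R) s) =
        wMass w (Ω ∩ CubeC (W.center R) s) := fun R s =>
    wMass_restrict_withDensity (hΩm.inter (measurableSet_cubeC _ _)) inter_subset_left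
  have hcΩ : ∀ R : W.cubes, W.center R ∈ Ω := fun R => W.subset_domain R.2 (W.center_mem R.2)
  have hr : ∀ R : W.cubes, 0 < W.radius R := fun R => W.radius_pos R R.2
  refine isCarlesonFamily_of_sparse (E := fun R : W.cubes => (R : Set (Rn n)))
    (fun R => W.measurableSet_cube R.2) (fun R => ?_) (fun P R hPR =>
      W.pairwise_disjoint P.2 R.2 (Subtype.coe_ne_coe.2 hPR)) (fun R => ?_) (fun s => ?_)
  · refine subset_inter (W.subset_domain R.2) ?_
    conv_lhs => rw [W.eq_cube R R.2]
    exact cubeC_subset_cubeC fun i => by simpa using le_mul_of_one_le_left (hr R).le hN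
  · rw [hmeas, wMass_restrict_withDensity (W.measurableSet_cube R.2) (W.subset_domain R.2)]
    refine (wMass_mono (inter_subset_inter_right _
      (cubeC_subset_cubeC (s := 2 ^ k * W.radius R) fun i => ?_))).trans
      ((hD.pow (hcΩ R) (hr R) k).trans ?_)
    · simpa using mul_le_mul_of_nonneg_right hk (hr R).le
    · refine mul_le_mul_right (wMass_mono ?_) _
      conv_rhs => rw [W.eq_cube R R.2]
      exact inter_subset_right
  · obtain ⟨t, hts, htd, hcov⟩ := Vitali.exists_disjoint_subfamily_covering_enlargement
      (fun R : W.cubes => Ω ∩ CubeC (W.center R) (N * W.radius R)) (s : Set W.cubes)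
      (fun R => N * W.radius R) 2 (by norm_num)
      (fun R _ => by have := hr R; positivity)
      (∑ R ∈ s, N * W.radius R)
      (fun R hR => Finset.single_le_sum (f := fun R : W.cubes => N * W.radius R)
        (fun R _ => by have := hr R; positivity) hR)
      (fun R _ => ⟨_, hcΩ R, mem_cubeC_self _ (by have := hr R; positivity)⟩)
    have htf : t.Finite := s.finite_toSet.subset hts
    refine ⟨htf.toFinset, fun R hR => hts (htf.mem_toFinset.1 hR), by simpa using htd, ?_⟩
    calc _ ≤ ((volume.restrict Ω).withDensity fun x => ENNReal.ofReal (w x))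
          (⋃ R ∈ htf.toFinset, Ω ∩ CubeC (W.center R) (2 ^ 3 * (N * W.radius R))) := by
          refine measure_mono (iUnion₂_subset fun P hP => ?_)
          obtain ⟨R, hR, ⟨y, hyP, hyR⟩, hPR⟩ := hcov P hP
          refine subset_trans ?_ (subset_biUnion_of_mem (u := fun R : W.cubes =>
            Ω ∩ CubeC (W.center R) (2 ^ 3 * (N * W.radius R))) (htf.mem_toFinset.2 hR))
          refine inter_subset_inter_right _ (cubeC_subset_cubeC fun i => ?_)
          have h2 := abs_sub_le_of_mem_cubeC hyP.2 i
          have h3 := abs_sub_le_of_mem_cubeC hyR.2 i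
          have h4 := abs_sub_le (W.center P i) (y i) (W.center R i)
          rw [abs_sub_comm (W.center P i) (y i)] at h4
          have h5 : 0 < N * W.radius R := by have := hr R; positivity
          linarith
      _ ≤ ∑ R ∈ htf.toFinset, ((volume.restrict Ω).withDensity fun x => ENNReal.ofReal (w x))
          (Ω ∩ CubeC (W.center R) (2 ^ 3 * (N * W.radius R))) := measure_biUnion_finset_le _ _
      _ ≤ _ := by
          rw [Finset.mul_sum]
          refine Finset.sum_le_sum fun R _ => ?_
          rw [hmeas, hmeas]
          exact hD.pow (hcΩ R) (by have := hr R; positivity) 3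

end WhitneyDecomp

/-- Telescoping along a list whose consecutive members are close. -/
lemma edist_le_sum_of_isChain {α : Type*} {r : α → α → Prop} (c : α → ℝ) (a : α → ℝ≥0∞)
    {s : Set α} (h : ∀ P ∈ s, ∀ Q ∈ s, r P Q → edist (c P) (c Q) ≤ a Q) (L : List α) {P Q : α}
    (hs : ∀ R ∈ P :: L, R ∈ s) (hc : (P :: L).IsChain r) (hQ : (P :: L).getLast? = some Q) :
    edist (c P) (c Q) ≤ (L.map a).sum := by
  induction L generalizing P with
  | nil =>
    simp only [List.getLast?_singleton, Option.some.injEq] at hQ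
    subst hQ
    simp
  | cons T L ih =>
    rw [List.isChain_cons_cons] at hc
    rw [List.getLast?_cons_cons] at hQ
    rw [List.map_cons, List.sum_cons]
    refine (edist_triangle _ (c T) _).trans
      (add_le_add (h _ (hs P (by simp)) _ (hs T (by simp)) hc.1) ?_)
    exact ih (fun S hS => hs S (List.mem_cons_of_mem _ hS)) hc.2 hQ

end Chaining

section Global

variable {n : ℕ} {Ω : Set (Rn n)} {Cdim cdim N : ℝ} {w u : Rn n → ℝ}

/-- The constant in the passage from the dilated Whitney cubes to the whole Boman domain. -/
def bomanConst (n : ℕ) (p q D Cdim M : ℝ) (k : ℕ) (Cl : ℝ≥0∞) : ℝ≥0∞ :=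
  2 ^ q * (Cl * ENNReal.ofReal Cdim ^ (q / p) +
    (ENNReal.ofReal D ^ k * ENNReal.ofReal D ^ 3 *
      ENNReal.ofReal (2 ^ (q / (q - 1)) * q)) ^ (q - 1) *
      (2 ^ q * (ENNReal.ofReal D ^ k * (2 ^ q * (2 * Cl)))) *
        (ENNReal.ofReal ((9 / 8 + 9 / 4 * M) * M) ^ n * ENNReal.ofReal Cdim) ^ (q / p))

lemma bomanConst_ne_top {p q D Cdim M : ℝ} {k : ℕ} {Cl : ℝ≥0∞} (hp : 0 < p) (hq : 1 < q)
    (hCl : Cl ≠ ∞) : bomanConst n p q D Cdim M k Cl ≠ ∞ := by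
  have hqp : 0 ≤ q / p := by positivity
  have hq0 : 0 ≤ q := by linarith
  have hq1 : 0 ≤ q - 1 := by linarith
  have h2 : (2 : ℝ≥0∞) ^ q ≠ ∞ := ENNReal.rpow_ne_top_of_nonneg hq0 (by simp)
  have hD : ∀ j : ℕ, ENNReal.ofReal D ^ j ≠ ∞ := fun j => ENNReal.pow_ne_top ENNReal.ofReal_ne_top
  refine ENNReal.mul_ne_top h2 (ENNReal.add_ne_top.2 ⟨ENNReal.mul_ne_top hCl
    (ENNReal.rpow_ne_top_of_nonneg hqp ENNReal.ofReal_ne_top), ENNReal.mul_ne_top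
      (ENNReal.mul_ne_top (ENNReal.rpow_ne_top_of_nonneg hq1
        (ENNReal.mul_ne_top (ENNReal.mul_ne_top (hD k) (hD 3)) ENNReal.ofReal_ne_top))
        (ENNReal.mul_ne_top h2 (ENNReal.mul_ne_top (hD k) (ENNReal.mul_ne_top h2
          (ENNReal.mul_ne_top (by simp) hCl)))))
      (ENNReal.rpow_ne_top_of_nonneg hqp (ENNReal.mul_ne_top
        (ENNReal.pow_ne_top ENNReal.ofReal_ne_top) ENNReal.ofReal_ne_top))⟩)

namespace WhitneyDecomp

variable (W : WhitneyDecomp n Ω Cdim)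

/-- The sum of `∫_{T*} f` over the Whitney cubes `T` with `T*` touching `R*`. -/
def neighborSum (f : Rn n → ℝ≥0∞) (R : Set (Rn n)) : ℝ≥0∞ :=
  ∑' T : W.cubes, {T : W.cubes | (Qstar W R ∩ Qstar W T).Nonempty}.indicator
    (fun T => ∫⁻ x in Qstar W T, f x) T

lemma lintegral_le_neighborSum {f : Rn n → ℝ≥0∞} {R T : Set (Rn n)} (hT : T ∈ W.cubes)
    (h : (Qstar W R ∩ Qstar W T).Nonempty) :
    ∫⁻ x in Qstar W T, f x ≤ W.neighborSum f R := by
  have h1 := ENNReal.le_tsum (f := fun T : W.cubes =>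
    {T : W.cubes | (Qstar W R ∩ Qstar W T).Nonempty}.indicator
      (fun T => ∫⁻ x in Qstar W T, f x) T) ⟨T, hT⟩
  rwa [indicator_of_mem (by exact h)] at h1

lemma neighborSum_ne_top (hΩo : IsOpen Ω) {f : Rn n → ℝ≥0∞}
    (hf : AEMeasurable f (volume.restrict Ω)) (hfin : ∫⁻ x in Ω, f x ≠ ∞) (R : Set (Rn n)) :
    W.neighborSum f R ≠ ∞ := by
  refine ne_top_of_le_ne_top (ENNReal.mul_ne_top ENNReal.ofReal_ne_top hfin)
    (le_trans (ENNReal.tsum_le_tsum fun T => ?_) (W.tsum_lintegral_Qstar_le hΩo f hf))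
  exact indicator_le_self _ _ T

lemma tsum_neighborSum_le (hn : 0 < n) (hΩb : Bornology.IsBounded Ω) (hΩo : IsOpen Ω) {M : ℝ}
    (hM : Cdim * (√n + Cdim) ≤ M) {f : Rn n → ℝ≥0∞} (hf : AEMeasurable f (volume.restrict Ω)) :
    ∑' R : W.cubes, W.neighborSum f R ≤
      ENNReal.ofReal ((9 / 8 + 9 / 4 * M) * M) ^ n * ENNReal.ofReal Cdim * ∫⁻ x in Ω, f x := by
  simp only [neighborSum]
  rw [ENNReal.tsum_comm, mul_assoc]
  refine le_trans ?_ (mul_le_mul_right (W.tsum_lintegral_Qstar_le hΩo f hf) _)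
  rw [← ENNReal.tsum_mul_left]
  refine ENNReal.tsum_le_tsum fun T => ?_
  refine le_trans (le_of_eq ?_) (mul_le_mul_left (W.tsum_neighbors_le hn hΩb hM T.2) _)
  rw [← ENNReal.tsum_mul_right]
  refine tsum_congr fun R => ?_
  by_cases h : (Qstar W R ∩ Qstar W T).Nonempty
  · rw [indicator_of_mem (by exact h), indicator_of_mem (by exact h), one_mul]
  · rw [indicator_of_notMem (by exact h), indicator_of_notMem (by exact h), zero_mul]

end WhitneyDecomp

/-- From Poincaré inequalities on the dilated Whitney cubes to a Poincaré inequality on the whole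
Boman domain. -/
theorem BomanDecomp.lintegral_edist_rpow_le (B : BomanDecomp n Ω Cdim cdim N) (hn : 0 < n)
    (hΩo : IsOpen Ω) (hΩb : Bornology.IsBounded Ω) {p q D M : ℝ} (hp : 1 < p) (hpq : p ≤ q)
    (hN : 1 ≤ N) (hM1 : 1 ≤ M) (hM : Cdim * (√n + Cdim) ≤ M) {k : ℕ}
    (hk : (N + 2) * (16 * M) + 1 ≤ 2 ^ k)
    (hw : LocallyIntegrableOn w Ω volume)
    (hwpos : ∀ᵐ x ∂(volume : Measure (Rn n)), x ∈ Ω → 0 < w x) (hD : DoublingIn Ω w D)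
    (c : Set (Rn n) → ℝ)
    (hum : ∀ T ∈ B.cubes, AEMeasurable u (volume.restrict (Qstar B.toWhitneyDecomp T)))
    {f : Rn n → ℝ≥0∞} (hf : AEMeasurable f (volume.restrict Ω)) (hfin : ∫⁻ x in Ω, f x ≠ ∞)
    {Cl : ℝ≥0∞} (hCl : Cl ≠ ∞)
    (hloc : ∀ T ∈ B.cubes, ∫⁻ y in Qstar B.toWhitneyDecomp T,
      edist (c T) (u y) ^ q * ENNReal.ofReal (w y) ≤
        Cl * (∫⁻ y in Qstar B.toWhitneyDecomp T, f y) ^ (q / p)) :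
    ∫⁻ y in Ω, edist (c B.central) (u y) ^ q * ENNReal.ofReal (w y) ≤
      bomanConst n p q D Cdim M k Cl * (∫⁻ y in Ω, f y) ^ (q / p) := by
  have hp0 : 0 < p := by linarith
  have hq : 1 < q := by linarith
  have hq0 : 0 < q := by linarith
  have hs : 1 ≤ q / p := (one_le_div hp0).2 hpq
  have hs0 : 0 ≤ q / p := by linarith
  set W := B.toWhitneyDecomp with hW
  have : Countable W.cubes := W.countable
  have hwm : AEMeasurable w (volume.restrict Ω) := hw.aestronglyMeasurable.aemeasurable
  have hΩm : MeasurableSet Ω := hΩo.measurableSet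
  set μ := (volume.restrict Ω).withDensity fun x => ENNReal.ofReal (w x) with hμ
  set V : Set (Rn n) → ℝ≥0∞ := fun R => wMass w (Ω ∩ CubeC (W.center R) (N * W.radius R)) with hV
  set A₀ : ℝ≥0∞ := ENNReal.ofReal D ^ k * (2 ^ q * (2 * Cl)) with hA₀
  have h2q : (2 : ℝ≥0∞) ^ q ≠ ∞ := ENNReal.rpow_ne_top_of_nonneg hq0.le (by simp)
  have hA₀t : A₀ ≠ ∞ := ENNReal.mul_ne_top (ENNReal.pow_ne_top ENNReal.ofReal_ne_top)
    (ENNReal.mul_ne_top h2q (ENNReal.mul_ne_top (by simp) hCl))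
  have hcΩ : ∀ R ∈ W.cubes, W.center R ∈ Ω := fun R hR => W.subset_domain hR (W.center_mem hR)
  have hNk : N ≤ 2 ^ k := by nlinarith
  have hRsub : ∀ R ∈ W.cubes, R ⊆ Ω ∩ CubeC (W.center R) (N * W.radius R) := by
    intro R hR
    refine subset_inter (W.subset_domain hR) ?_
    conv_lhs => rw [W.eq_cube R hR]
    exact cubeC_subset_cubeC fun i => by
      simpa using le_mul_of_one_le_left (W.radius_pos R hR).le hN
  have hV0 : ∀ R ∈ W.cubes, V R ≠ 0 := by
    intro R hR h
    have hR0 : wMass w R ≠ 0 := by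
      refine wMass_ne_zero (W.measurableSet_cube hR) (W.subset_domain hR) ?_
        (hwm.mono_measure (Measure.restrict_mono (W.subset_domain hR) le_rfl)) hwpos
      rw [W.eq_cube R hR, volume_cubeC]
      exact pow_ne_zero _ (by simpa using W.radius_pos R hR)
    exact hR0 (le_antisymm ((wMass_mono (hRsub R hR)).trans h.le) zero_le)
  have hVt : ∀ R ∈ W.cubes, V R ≠ ∞ := by
    intro R hR
    have hrR := W.radius_pos R hR
    have hRt : wMass w (Ω ∩ CubeC (W.center R) (W.radius R)) ≠ ∞ := by
      refine wMass_ne_top hw (W.isCompact_closure_Qstar hΩb hΩo hR)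
        (W.closure_Qstar_subset hΩo hR) (inter_subset_right.trans ?_)
      rw [← W.eq_cube R hR]
      exact (W.subset_Qstar hR).trans subset_closure
    refine ne_top_of_le_ne_top (ENNReal.mul_ne_top (ENNReal.pow_ne_top ENNReal.ofReal_ne_top) hRt)
      (le_trans (wMass_mono (inter_subset_inter_right _ (cubeC_subset_cubeC fun i => ?_)))
        (hD.pow (hcΩ R hR) hrR k))
    simpa using mul_le_mul_of_nonneg_right hNk hrR.le
  set S := W.neighborSum f with hS
  have hSt : ∀ R, S R ≠ ∞ := W.neighborSum_ne_top hΩo hf hfin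
  set a : Set (Rn n) → ℝ≥0∞ := fun R => 2 * (A₀ * S R ^ (q / p) / V R) ^ q⁻¹ with ha
  have hat : ∀ R ∈ W.cubes, a R ≠ ∞ := fun R hR =>
    ENNReal.mul_ne_top (by simp) (ENNReal.rpow_ne_top_of_nonneg (by positivity)
      (ENNReal.div_ne_top (ENNReal.mul_ne_top hA₀t (ENNReal.rpow_ne_top_of_nonneg hs0 (hSt R)))
        (hV0 R hR)))
  have haq : ∀ R ∈ W.cubes, a R ^ q * V R = 2 ^ q * A₀ * S R ^ (q / p) := by
    intro R hR
    simp only [ha]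
    rw [ENNReal.mul_rpow_of_nonneg _ _ hq0.le, ENNReal.rpow_inv_rpow hq0.ne', mul_assoc,
      ENNReal.div_mul_cancel (hV0 R hR) (hVt R hR), ← mul_assoc]
  have hstep : ∀ P ∈ W.cubes, ∀ T ∈ W.cubes, ∀ Q ∈ W.cubes, ∀ x ∈ T, x ∈ Qstar W P →
      x ∈ Qstar W Q → edist (c P) (c T) ≤ (A₀ * S Q ^ (q / p) / V Q) ^ q⁻¹ := by
    intro P hP T hT Q hQ x hxT hxP hxQ
    have hQP : (Qstar W Q ∩ Qstar W P).Nonempty := ⟨x, hxQ, hxP⟩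
    have hQT : (Qstar W Q ∩ Qstar W T).Nonempty := ⟨x, hxQ, W.subset_Qstar hT hxT⟩
    have hcomp : ∀ T' ∈ W.cubes, (Qstar W Q ∩ Qstar W T').Nonempty →
        W.radius Q ≤ M * W.radius T' := fun T' hT' h =>
      (W.radius_le_of_inter_nonempty hn hΩb hT' hQ (by rwa [inter_comm])).trans
        (mul_le_mul_of_nonneg_right hM (W.radius_pos T' hT').le)
    rw [ENNReal.le_rpow_inv_iff hq0, ENNReal.le_div_iff_mul_le (Or.inl (hV0 Q hQ))
      (Or.inl (hVt Q hQ))]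
    refine (W.edist_average_rpow_mul_le hΩo hq0 hwm hD hM1 hk hP hT hQ hxT hxP hxQ
      (hcomp P hP hQP) (hcomp T hT hQT) (hum P hP) (c P) (c T)).trans ?_
    rw [hA₀, mul_assoc, mul_assoc, mul_assoc, two_mul]
    gcongr _ * (_ * ?_)
    rw [← two_mul, two_mul]
    refine add_le_add ((hloc P hP).trans ?_) ((hloc T hT).trans ?_)
    · gcongr
      exact W.lintegral_le_neighborSum hP hQP
    · gcongr
      exact W.lintegral_le_neighborSum hT hQT
  have hlink : ∀ P ∈ W.cubes, ∀ Q ∈ W.cubes, ChainLink W cdim P Q →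
      edist (c P) (c Q) ≤ a Q := by
    rintro P hP Q hQ ⟨z, r, hr, hz, -⟩
    have hx := hz (mem_cubeC_self z hr)
    have hxΩ : z ∈ ⋃₀ W.cubes := by
      rw [W.union_eq]
      exact W.Qstar_subset hΩo hP hx.1
    obtain ⟨T, hT, hxT⟩ := hxΩ
    refine (edist_triangle_right _ _ (c T)).trans ?_
    simp only [ha]
    rw [two_mul]
    exact add_le_add (hstep P hP T hT Q hQ z hxT hx.1 hx.2) (hstep Q hQ T hT Q hQ z hxT hx.2 hx.2)
  set F : Rn n → ℝ≥0∞ := fun x => ∑' R : W.cubes,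
    (Ω ∩ CubeC (W.center R) (N * W.radius R)).indicator (fun _ => a R) x with hF
  have hFm : Measurable F := Measurable.tsum fun R =>
    measurable_const.indicator (hΩm.inter (measurableSet_cubeC _ _))
  have hchain : ∀ Q ∈ W.cubes, ∀ x ∈ Q, edist (c B.central) (c Q) ≤ F x := by
    intro Q hQ x hx
    obtain ⟨hL, hnd, hhead, hlast, hch⟩ := B.chain_isChain Q hQ
    have hshadow : ∀ R ∈ B.chain Q, x ∈ Ω ∩ CubeC (W.center R) (N * W.radius R) :=
      fun R hR => ⟨W.subset_domain hQ hx, B.shadow_subset R (hL R hR) Q hQ hR hx⟩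
    obtain ⟨L, hLeq⟩ : ∃ L, B.chain Q = B.central :: L := List.head?_eq_some_iff.1 hhead
    rw [hLeq] at hL hnd hlast hch hshadow
    refine (edist_le_sum_of_isChain (s := W.cubes) c a hlink L hL hch hlast).trans ?_
    have hsum : (L.map a).sum = ∑ R ∈ L.toFinset, a R := by
      rw [List.sum_toFinset _ (List.nodup_cons.1 hnd).2]
    rw [hsum]
    calc ∑ R ∈ L.toFinset, a R
        = ∑ R ∈ L.toFinset.attach, (Ω ∩ CubeC (W.center R) (N * W.radius R)).indicator
            (fun _ => a R) x := by
          rw [← Finset.sum_attach]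
          refine Finset.sum_congr rfl fun R _ => ?_
          rw [indicator_of_mem]
          exact hshadow R (List.mem_cons_of_mem _ (List.mem_toFinset.1 R.2))
      _ ≤ ∑' R : L.toFinset, (Ω ∩ CubeC (W.center R) (N * W.radius R)).indicator
            (fun _ => a R) x := ENNReal.sum_le_tsum _
      _ ≤ F x := ENNReal.tsum_comp_le_tsum_of_injective
          (f := fun R : L.toFinset => (⟨R, hL R (List.mem_cons_of_mem _
            (List.mem_toFinset.1 R.2))⟩ : W.cubes))
          (fun R R' h => Subtype.ext (Subtype.mk.inj h)) _
  have hunion : Ω = ⋃ Q : W.cubes, (Q : Set (Rn n)) := by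
    rw [← sUnion_eq_iUnion, W.union_eq]
  have hsplit : ∀ g : Rn n → ℝ≥0∞, ∫⁻ y in Ω, g y =
      ∑' Q : W.cubes, ∫⁻ y in (Q : Set (Rn n)), g y := by
    intro g
    conv_lhs => rw [hunion]
    exact lintegral_iUnion (fun Q : W.cubes => W.measurableSet_cube Q.2)
      (fun P R hPR => W.pairwise_disjoint P.2 R.2 (Subtype.coe_ne_coe.2 hPR)) g
  have hoverlap := W.tsum_lintegral_Qstar_le hΩo f hf
  have hosc : ∑' Q : W.cubes, ∫⁻ y in (Q : Set (Rn n)),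
      edist (c Q) (u y) ^ q * ENNReal.ofReal (w y) ≤
      Cl * ENNReal.ofReal Cdim ^ (q / p) * (∫⁻ y in Ω, f y) ^ (q / p) := by
    calc ∑' Q : W.cubes, ∫⁻ y in (Q : Set (Rn n)), edist (c Q) (u y) ^ q * ENNReal.ofReal (w y)
        ≤ ∑' Q : W.cubes, Cl * (∫⁻ y in Qstar W Q, f y) ^ (q / p) :=
          ENNReal.tsum_le_tsum fun Q =>
            (lintegral_mono_set (W.subset_Qstar Q.2)).trans (hloc Q Q.2)
      _ ≤ Cl * (∑' Q : W.cubes, ∫⁻ y in Qstar W Q, f y) ^ (q / p) := by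
          rw [ENNReal.tsum_mul_left]
          gcongr
          exact ENNReal.tsum_rpow_le_rpow_tsum _ hs
      _ ≤ Cl * (ENNReal.ofReal Cdim * ∫⁻ y in Ω, f y) ^ (q / p) := by gcongr
      _ = _ := by rw [ENNReal.mul_rpow_of_nonneg _ _ hs0, mul_assoc]
  have hchains : ∫⁻ y in Ω, F y ^ q * ENNReal.ofReal (w y) ≤
      (ENNReal.ofReal D ^ k * ENNReal.ofReal D ^ 3 *
        ENNReal.ofReal (2 ^ (q / (q - 1)) * q)) ^ (q - 1) * (2 ^ q * A₀) *
        (ENNReal.ofReal ((9 / 8 + 9 / 4 * M) * M) ^ n * ENNReal.ofReal Cdim) ^ (q / p) *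
          (∫⁻ y in Ω, f y) ^ (q / p) := by
    have hmeas : ∀ R : W.cubes, μ (Ω ∩ CubeC (W.center R) (N * W.radius R)) = V R := fun R =>
      wMass_restrict_withDensity (hΩm.inter (measurableSet_cubeC _ _)) inter_subset_left
    calc ∫⁻ y in Ω, F y ^ q * ENNReal.ofReal (w y) = ∫⁻ y, F y ^ q ∂μ := by
          rw [hμ, lintegral_withDensity_eq_lintegral_mul₀ hwm.ennreal_ofReal
            (hFm.pow_const q).aemeasurable]
          exact lintegral_congr fun y => mul_comm _ _
      _ ≤ (ENNReal.ofReal D ^ k * ENNReal.ofReal D ^ 3 *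
            ENNReal.ofReal (2 ^ (q / (q - 1)) * q)) ^ (q - 1) *
            ∑' R : W.cubes, a R ^ q * μ (Ω ∩ CubeC (W.center R) (N * W.radius R)) :=
          (W.isCarlesonFamily_dilates hN hΩm hD hNk).lintegral_tsum_indicator_rpow_le
            (fun R => hΩm.inter (measurableSet_cubeC _ _))
            (fun R => by rw [hmeas]; exact hVt R R.2) hq (fun R => hat R R.2)
      _ = (ENNReal.ofReal D ^ k * ENNReal.ofReal D ^ 3 *
            ENNReal.ofReal (2 ^ (q / (q - 1)) * q)) ^ (q - 1) * (2 ^ q * A₀) *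
            ∑' R : W.cubes, S R ^ (q / p) := by
          rw [mul_assoc (_ ^ (q - 1)), ← ENNReal.tsum_mul_left (a := 2 ^ q * A₀)]
          congr 1
          refine tsum_congr fun R => ?_
          rw [hmeas, haq R R.2]
      _ ≤ _ := by
          rw [mul_assoc (_ * _) (_ ^ (q / p)), ← ENNReal.mul_rpow_of_nonneg _ _ hs0]
          gcongr
          refine (ENNReal.tsum_rpow_le_rpow_tsum _ hs).trans ?_
          gcongr
          exact W.tsum_neighborSum_le hn hΩb hΩo hM hf
  calc ∫⁻ y in Ω, edist (c B.central) (u y) ^ q * ENNReal.ofReal (w y)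
      = ∑' Q : W.cubes, ∫⁻ y in (Q : Set (Rn n)),
          edist (c B.central) (u y) ^ q * ENNReal.ofReal (w y) := hsplit _
    _ ≤ ∑' Q : W.cubes, ∫⁻ y in (Q : Set (Rn n)), 2 ^ q *
          (edist (c Q) (u y) ^ q * ENNReal.ofReal (w y) + F y ^ q * ENNReal.ofReal (w y)) := by
        refine ENNReal.tsum_le_tsum fun Q =>
          setLIntegral_mono' (W.measurableSet_cube Q.2) fun y hy => ?_
        rw [← add_mul, ← mul_assoc]
        gcongr
        refine le_trans ?_ (ENNReal.add_rpow_le_two_rpow _ _ hq0)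
        gcongr
        rw [add_comm]
        exact (edist_triangle _ (c Q) _).trans (by gcongr; exact hchain Q Q.2 y hy)
    _ = 2 ^ q * ((∑' Q : W.cubes, ∫⁻ y in (Q : Set (Rn n)),
          edist (c Q) (u y) ^ q * ENNReal.ofReal (w y)) +
            ∫⁻ y in Ω, F y ^ q * ENNReal.ofReal (w y)) := by
        rw [hsplit fun y => F y ^ q * ENNReal.ofReal (w y), ← ENNReal.tsum_add,
          ← ENNReal.tsum_mul_left]
        refine tsum_congr fun Q => ?_
        rw [lintegral_const_mul' _ _ h2q, lintegral_add_right']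
        exact (hFm.pow_const q).aemeasurable.mul (hwm.mono_measure
          (Measure.restrict_mono (W.subset_domain Q.2) le_rfl)).ennreal_ofReal
    _ ≤ _ := by
        refine (mul_le_mul_right (add_le_add hosc hchains) _).trans (le_of_eq ?_)
        rw [bomanConst]
        ring

end Global

section

variable {n : ℕ} {Ω : Set (Rn n)} {w v u : Rn n → ℝ}

/-- The two-weight Poincaré inequality on a cube compactly contained in `Ω`, for locally Lipschitz
functions on `Ω`. -/
lemma local_two_weight_poincare_of_locally_lipschitz (hn : 0 < n) {p q : ℝ} (hp : 1 < p)
    (hpq : p ≤ q) {x : Rn n} {r : ℝ} (hr : 0 < r) (hΩo : IsOpen Ω)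
    (hcpt : IsCompact (closure (CubeC x r))) (hsub : closure (CubeC x r) ⊆ Ω)
    (hw : LocallyIntegrableOn w Ω volume)
    (hwpos : ∀ᵐ x ∂(volume : Measure (Rn n)), x ∈ Ω → 0 < w x)
    (hv : LocallyIntegrableOn v Ω volume)
    (hvpos : ∀ᵐ x ∂(volume : Measure (Rn n)), x ∈ Ω → 0 < v x)
    {Cw δw Cσ δσ : ℝ} (hδw : 0 < δw) (hδσ : 0 < δσ) {a K : ℝ≥0∞} (ha1 : 1 < a) (hat : a ≠ ∞)
    (hKt : K ≠ ∞)
    (haw : ENNReal.ofReal Cw * (2 ^ n / a) ^ δw ≤ 2⁻¹)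
    (haσ : ENNReal.ofReal Cσ * (2 ^ n / a) ^ δσ ≤ 2⁻¹)
    (hAw : ∀ R : Set (Rn n), IsDyadicSubC x r R → ∀ E : Set (Rn n), MeasurableSet E → E ⊆ R →
      wMass w E ≤ ENNReal.ofReal Cw * (volume E / volume R) ^ δw * wMass w R)
    (hAσ : ∀ R : Set (Rn n), IsDyadicSubC x r R → ∀ E : Set (Rn n), MeasurableSet E → E ⊆ R →
      wMass (fun x => v x ^ (-(1 / (p - 1)))) E ≤
        ENNReal.ofReal Cσ * (volume E / volume R) ^ δσ * wMass (fun x => v x ^ (-(1 / (p - 1)))) R)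
    (hK : ∀ R : Set (Rn n), IsDyadicSubC x r R →
      volume R ^ (-(1 - 1 / (n : ℝ)) * p) * wMass w R ^ (p / q) *
        wMass (fun x => v x ^ (-(1 / (p - 1)))) R ^ (p - 1) ≤ K)
    (hu : ∀ Kc : Set (Rn n), Kc ⊆ Ω → IsCompact Kc → ∃ L : ℝ≥0, LipschitzOnWith L u Kc) :
    AEMeasurable u (volume.restrict (CubeC x r)) ∧
    ∫⁻ y in CubeC x r, edist (⨍ z in CubeC x r, u z) (u y) ^ q * ENNReal.ofReal (w y) ≤
      localConst n p q (K ^ (1 / p)) a *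
        (∫⁻ y in CubeC x r,
          ENNReal.ofReal ‖fderiv ℝ u y‖ ^ p * ENNReal.ofReal (v y)) ^ (q / p) := by
  have hQΩ : CubeC x r ⊆ Ω := subset_closure.trans hsub
  have hQm := measurableSet_cubeC x r
  obtain ⟨L, g, hg, hug⟩ := exists_lipschitzWith_eventuallyEq hu hΩo hcpt hsub
  have heq : ∀ y ∈ CubeC x r, u y = g y := fun y hy => (hug y (subset_closure hy)).eq_of_nhds
  have hfd : ∀ y ∈ CubeC x r, fderiv ℝ u y = fderiv ℝ g y := fun y hy =>
    (hug y (subset_closure hy)).fderiv_eq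
  have hres : volume.restrict (CubeC x r) ≤ volume.restrict Ω :=
    Measure.restrict_mono hQΩ le_rfl
  have hwm := hw.aestronglyMeasurable.aemeasurable.mono_measure hres
  have hvm := hv.aestronglyMeasurable.aemeasurable.mono_measure hres
  refine ⟨hg.continuous.measurable.aemeasurable.congr ?_, ?_⟩
  · filter_upwards [ae_restrict_mem hQm] with y hy using (heq y hy).symm
  have hmain := local_two_weight_poincare hn hp hpq hr hwm hvm
    (by filter_upwards [ae_restrict_of_ae hvpos, ae_restrict_mem hQm] with y h1 h2
      using h1 (hQΩ h2))
    (wMass_ne_zero hQm hQΩ (by rw [volume_cubeC]; exact pow_ne_zero _ (by simpa using hr))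
      hwm hwpos)
    (wMass_ne_top hw hcpt hsub subset_closure) hδw hδσ ha1 hat hKt haw haσ hAw hAσ hK hg
  have havg : ⨍ z in CubeC x r, u z = ⨍ z in CubeC x r, g z :=
    setAverage_congr_fun hQm (Filter.Eventually.of_forall heq)
  rw [havg]
  refine le_trans (le_of_eq ?_) (hmain.trans (le_of_eq ?_))
  · exact setLIntegral_congr_fun hQm fun y hy => by simp only [heq y hy]
  · congr 2
    exact setLIntegral_congr_fun hQm fun y hy => by simp only [hfd y hy, ofReal_norm]

end

/-- main two-weight theorem: let `Ω ⊆ ℝ^n` be a bounded Boman domain with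
constant `N`, `1 < p ≤ q < ∞`, `w` doubling in `Ω` with constant `D`, and
`σ = v^{−1/(p−1)}`. Assume that `w` and `σ` satisfy the dyadic `A_∞` condition with
constants `Cw, δw` resp. `Cσ, δσ` on the dyadic subcubes of every dilated Whitney cube
`Q*`, and that `|R|^{−(1−1/n)p} w(R)^{p/q} σ(R)^{p−1} ≤ K` for all such dyadic cubes `R`.
Then for every `u ∈ Lip_loc(Ω)`,
`(inf_c ∫_Ω |u − c|^q w dx)^{1/q} ≤ C (∫_Ω |∇u|^p v dx)^{1/p}`,
with `C = C(n, p, q, N, D, K, Cw, Cσ, δw, δσ) > 0`. -/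
theorem main_two_weight_poincare_on_boman_domain
    (n : ℕ) (hn : 0 < n) (p q N D K Cw δw Cσ δσ Cdim cdim : ℝ)
    (hp : 1 < p) (hpq : p ≤ q) (hN : 1 ≤ N) (hD : 0 < D) (hK : 0 < K)
    (hCw : 0 < Cw) (hδw : 0 < δw) (hCσ : 0 < Cσ) (hδσ : 0 < δσ) :
    ∃ C : ℝ, 0 < C ∧
      ∀ Ω : Set (Rn n), IsOpen Ω → IsConnected Ω → Bornology.IsBounded Ω →
      ∀ B : BomanDecomp n Ω Cdim cdim N,
      ∀ w v : Rn n → ℝ,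
        LocallyIntegrableOn w Ω volume →
        (∀ᵐ x ∂(volume : Measure (Rn n)), x ∈ Ω → 0 < w x) →
        LocallyIntegrableOn v Ω volume →
        (∀ᵐ x ∂(volume : Measure (Rn n)), x ∈ Ω → 0 < v x) →
        DoublingIn Ω w D →
        (∀ Q ∈ B.cubes, ∀ R : Set (Rn n),
          IsDyadicSubC (B.center Q) (9 / 8 * B.radius Q) R →
          ∀ E : Set (Rn n), MeasurableSet E → E ⊆ R →
            wMass w E ≤ ENNReal.ofReal Cw * (volume E / volume R) ^ δw * wMass w R) →
        (∀ Q ∈ B.cubes, ∀ R : Set (Rn n),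
          IsDyadicSubC (B.center Q) (9 / 8 * B.radius Q) R →
          ∀ E : Set (Rn n), MeasurableSet E → E ⊆ R →
            wMass (fun x => v x ^ (-(1 / (p - 1)))) E ≤
              ENNReal.ofReal Cσ * (volume E / volume R) ^ δσ *
                wMass (fun x => v x ^ (-(1 / (p - 1)))) R) →
        (∀ Q ∈ B.cubes, ∀ R : Set (Rn n),
          IsDyadicSubC (B.center Q) (9 / 8 * B.radius Q) R →
            volume R ^ (-(1 - 1 / (n : ℝ)) * p) * wMass w R ^ (p / q) *
              wMass (fun x => v x ^ (-(1 / (p - 1)))) R ^ (p - 1) ≤ ENNReal.ofReal K) →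
      ∀ u : Rn n → ℝ,
        (∀ Kc : Set (Rn n), Kc ⊆ Ω → IsCompact Kc → ∃ L : ℝ≥0, LipschitzOnWith L u Kc) →
        (⨅ c : ℝ, ∫⁻ x in Ω, (ENNReal.ofReal |u x - c|) ^ q * ENNReal.ofReal (w x)) ^ (1 / q) ≤
          ENNReal.ofReal C *
            (∫⁻ x in Ω, (ENNReal.ofReal ‖fderiv ℝ u x‖) ^ p * ENNReal.ofReal (v x)) ^ (1 / p) := by
  have hp0 : 0 < p := by linarith
  have hq1 : 1 < q := by linarith
  have hq0 : 0 < q := by linarith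
  set M : ℝ := max 1 (Cdim * (√n + Cdim)) with hM
  obtain ⟨k, hk⟩ := pow_unbounded_of_one_lt ((N + 2) * (16 * M) + 1) (one_lt_two (α := ℝ))
  have h2n : (2 : ℝ≥0∞) ^ n ≠ ∞ := ENNReal.pow_ne_top (by simp)
  obtain ⟨a₁, ha₁, hw₁⟩ := exists_stopping_ratio (2 ^ n) h2n Cw hδw
  obtain ⟨a₂, ha₂, hσ₂⟩ := exists_stopping_ratio (2 ^ n) h2n Cσ hδσ
  set a : ℝ≥0∞ := max (max a₁ a₂) 2 with ha
  have hat : a ≠ ∞ := by simp [ha, ha₁, ha₂]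
  have ha1 : 1 < a := lt_of_lt_of_le (by norm_num) (le_max_right _ _)
  have haw := hw₁ a ((le_max_left _ _).trans (le_max_left _ _)) hat
  have haσ := hσ₂ a ((le_max_right _ _).trans (le_max_left _ _)) hat
  set Cl := localConst n p q (ENNReal.ofReal K ^ (1 / p)) a with hCl
  have hClt : Cl ≠ ∞ := localConst_ne_top hp hpq
    (ENNReal.rpow_ne_top_of_nonneg (by positivity) ENNReal.ofReal_ne_top) hat
  set Cg := bomanConst n p q D Cdim M k Cl with hCg
  have hCgt : Cg ^ (1 / q) ≠ ∞ :=
    ENNReal.rpow_ne_top_of_nonneg (by positivity) (bomanConst_ne_top hp0 hq1 hClt)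
  refine ⟨(Cg ^ (1 / q)).toReal + 1, by positivity, ?_⟩
  intro Ω hΩo _ hΩb B w v hw hwpos hv hvpos hdoub hAw hAσ hKc u hu
  have hCle : Cg ^ (1 / q) ≤ ENNReal.ofReal ((Cg ^ (1 / q)).toReal + 1) := by
    rw [ENNReal.le_ofReal_iff_toReal_le hCgt (by positivity)]
    linarith
  set f : Rn n → ℝ≥0∞ := fun x => ENNReal.ofReal ‖fderiv ℝ u x‖ ^ p * ENNReal.ofReal (v x) with hf
  by_cases hfin : ∫⁻ x in Ω, f x = ∞
  · have hC0 : ENNReal.ofReal ((Cg ^ (1 / q)).toReal + 1) ≠ 0 := by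
      rw [ENNReal.ofReal_ne_zero_iff]
      positivity
    rw [hfin, ENNReal.top_rpow_of_pos (by positivity), ENNReal.mul_top hC0]
    exact le_top
  have hfm : AEMeasurable f (volume.restrict Ω) :=
    ((measurable_fderiv ℝ u).norm.ennreal_ofReal.pow_const p).aemeasurable.mul
      hv.aestronglyMeasurable.aemeasurable.ennreal_ofReal
  have hloc := fun (T : Set (Rn n)) (hT : T ∈ B.cubes) =>
    local_two_weight_poincare_of_locally_lipschitz (x := B.center T)
      (r := 9 / 8 * B.radius T) hn hp hpq
      (by have := B.radius_pos T hT; positivity) hΩo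
      (B.toWhitneyDecomp.isCompact_closure_Qstar hΩb hΩo hT)
      (B.toWhitneyDecomp.closure_Qstar_subset hΩo hT) hw hwpos hv hvpos hδw hδσ ha1 hat
      ENNReal.ofReal_ne_top haw haσ (hAw T hT) (hAσ T hT) (hKc T hT) hu
  have hglob := B.lintegral_edist_rpow_le hn hΩo hΩb hp hpq hN (le_max_left _ _) (le_max_right _ _)
    hk.le hw hwpos hdoub (fun T => ⨍ z in Qstar B.toWhitneyDecomp T, u z)
    (fun T hT => (hloc T hT).1) hfm hfin hClt (fun T hT => (hloc T hT).2)
  set c₀ := ⨍ z in Qstar B.toWhitneyDecomp B.central, u z with hc₀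
  calc (⨅ c : ℝ, ∫⁻ x in Ω, ENNReal.ofReal |u x - c| ^ q * ENNReal.ofReal (w x)) ^ (1 / q)
      ≤ (∫⁻ x in Ω, ENNReal.ofReal |u x - c₀| ^ q * ENNReal.ofReal (w x)) ^ (1 / q) := by
        gcongr
        exact iInf_le _ c₀
    _ ≤ (Cg * (∫⁻ x in Ω, f x) ^ (q / p)) ^ (1 / q) := by
        gcongr
        refine le_trans (le_of_eq ?_) hglob
        refine lintegral_congr fun x => ?_
        rw [edist_comm, edist_dist, Real.dist_eq]
    _ = Cg ^ (1 / q) * (∫⁻ x in Ω, f x) ^ (1 / p) := by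
        rw [ENNReal.mul_rpow_of_nonneg _ _ (by positivity), ← ENNReal.rpow_mul]
        congr 2
        field_simp
    _ ≤ _ := by gcongr
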